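/- arXiv:2605.05243 — 10 statements merged into one kernel-verified Lean document; each statement's English description precedes it below -/
import Mathlib

section
/- Let d ≥ 3. Then the minimum of the Shannon entropy H(P_x) over all x ∈ ℝ^d with ‖x‖_2 = 1 and x_1 + ⋯ + x_d = 0 equals log 2 if 3 ≤ d ≤ 6, and equals log d − ((d−2)/d) log(d−1) if d ≥ 7. -/
/-- A function on `[0, 1]` which is nonnegative at both ends, with derivative nonnegative at `0` and
nonpositive at `1`, is nonnegative if its third derivative never passes from positive to
negative. -/
lemma nonneg_of_third_deriv_sign {G G₁ G₂ G₃ : ℝ → ℝ}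
    (hG : ContinuousOn G (Set.Icc 0 1)) (hG₁ : ContinuousOn G₁ (Set.Icc 0 1))
    (h₁ : ∀ x ∈ Set.Ioo (0 : ℝ) 1, HasDerivAt G (G₁ x) x)
    (h₂ : ∀ x ∈ Set.Ioo (0 : ℝ) 1, HasDerivAt G₁ (G₂ x) x)
    (h₃ : ∀ x ∈ Set.Ioo (0 : ℝ) 1, HasDerivAt G₂ (G₃ x) x)
    (hsign : ∀ x y : ℝ, 0 < x → x < y → y < 1 → 0 < G₃ x → 0 ≤ G₃ y)
    (a0 : 0 ≤ G 0) (a1 : 0 ≤ G₁ 0) (b0 : 0 ≤ G 1) (b1 : G₁ 1 ≤ 0)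
    {s : ℝ} (hs : s ∈ Set.Icc (0 : ℝ) 1) : 0 ≤ G s := by
  by_contra! hneg
  have hs0 : 0 < s := lt_of_le_of_ne hs.1 (by rintro rfl; linarith)
  have hs1 : s < 1 := lt_of_le_of_ne hs.2 (by rintro rfl; linarith)
  have mvt : ∀ {f f' : ℝ → ℝ}, ContinuousOn f (Set.Icc 0 1) →
      (∀ x ∈ Set.Ioo (0 : ℝ) 1, HasDerivAt f (f' x) x) → ∀ u v : ℝ, 0 ≤ u → u < v → v ≤ 1 →
      ∃ c, u < c ∧ c < v ∧ f' c * (v - u) = f v - f u := by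
    intro f f' hf hf' u v hu huv hv
    obtain ⟨c, hc, h⟩ := exists_hasDerivAt_eq_slope f f' huv
      (hf.mono (Set.Icc_subset_Icc hu hv))
      (fun x hx => hf' x ⟨hu.trans_lt hx.1, hx.2.trans_le hv⟩)
    exact ⟨c, hc.1, hc.2, by rw [h]; field_simp [(sub_pos.2 huv).ne']⟩
  obtain ⟨p, hp0, hps, hp⟩ := mvt hG h₁ 0 s le_rfl hs0 hs.2
  obtain ⟨q, hsq, hq1, hq⟩ := mvt hG h₁ s 1 hs.1 hs1 le_rfl
  have hp' : G₁ p < 0 := by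
    by_contra! h
    linarith [mul_nonneg h (sub_nonneg.2 hs.1)]
  have hq' : 0 < G₁ q := by
    by_contra! h
    linarith [mul_nonneg (neg_nonneg.2 h) (sub_nonneg.2 hs.2)]
  obtain ⟨a, ha0, hap, ha⟩ := mvt hG₁ h₂ 0 p le_rfl hp0 (by linarith)
  obtain ⟨b, hpb, hbq, hb⟩ := mvt hG₁ h₂ p q hp0.le (by linarith) hq1.le
  obtain ⟨c, hqc, hc1, hc⟩ := mvt hG₁ h₂ q 1 (by linarith) hq1 le_rfl
  have ha' : G₂ a < 0 := by
    by_contra! h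
    linarith [mul_nonneg h (sub_nonneg.2 hp0.le)]
  have hb' : 0 < G₂ b := by
    by_contra! h
    linarith [mul_nonneg (neg_nonneg.2 h) (sub_nonneg.2 (hps.trans hsq).le)]
  have hc' : G₂ c < 0 := by
    by_contra! h
    linarith [mul_nonneg h (sub_nonneg.2 hq1.le)]
  have mvt₂ : ∀ u v : ℝ, 0 < u → u < v → v < 1 →
      ∃ c, u < c ∧ c < v ∧ G₃ c * (v - u) = G₂ v - G₂ u := by
    intro u v hu huv hv
    obtain ⟨c, hc, h⟩ := exists_hasDerivAt_eq_slope G₂ G₃ huv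
      (fun x hx => (h₃ x ⟨hu.trans_le hx.1, hx.2.trans_lt hv⟩).continuousAt.continuousWithinAt)
      (fun x hx => h₃ x ⟨hu.trans hx.1, hx.2.trans hv⟩)
    exact ⟨c, hc.1, hc.2, by rw [h]; field_simp [(sub_pos.2 huv).ne']⟩
  obtain ⟨u, hau, hub, hu⟩ := mvt₂ a b ha0 (by linarith) (by linarith)
  obtain ⟨v, hbv, hvc, hv⟩ := mvt₂ b c (by linarith) (by linarith) hc1
  have hu' : 0 < G₃ u := by
    by_contra! h
    linarith [mul_nonneg (neg_nonneg.2 h) (sub_nonneg.2 (hau.trans hub).le)]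
  have hv' := hsign u v (by linarith) (by linarith) (by linarith) hu'
  linarith [mul_nonneg hv' (sub_nonneg.2 (hbv.trans hvc).le)]

/-- The entropy bound for the vectors proportional to `(1 + m s, -1, -s, …, -s)`, with `m` entries
equal to `-s`. -/
lemma entropy_curve_bound {m e E s : ℝ} (hm : 1 ≤ m) (he : e ≤ Real.log 2) (heE : e ≤ E)
    (hE : E = Real.log (m + 2) - m / (m + 2) * Real.log (m + 1)) (hs : s ∈ Set.Icc (0 : ℝ) 1) :
    (2 + 2 * m * s + m * (m + 1) * s ^ 2) * e ≤
      (2 + 2 * m * s + m * (m + 1) * s ^ 2) * Real.log (2 + 2 * m * s + m * (m + 1) * s ^ 2)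
        - 2 * (1 + m * s) ^ 2 * Real.log (1 + m * s) - 2 * m * s ^ 2 * Real.log s := by
  set κ := (m + 1) * (m + 2) * (E - e) with hκ
  have hκ0 : 0 ≤ κ := mul_nonneg (by positivity) (sub_nonneg.2 heE)
  let N : ℝ → ℝ := fun s => 2 + 2 * m * s + m * (m + 1) * s ^ 2
  let N' : ℝ → ℝ := fun s => 2 * m + 2 * m * (m + 1) * s
  let y : ℝ → ℝ := fun s => 1 + m * s
  have hN : ∀ s, 0 ≤ s → 0 < N s := fun s hs => by simp only [N]; positivity
  have hy : ∀ s, 0 ≤ s → 0 < y s := fun s hs => by simp only [y]; positivity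
  have dN : ∀ s, HasDerivAt N (N' s) s := fun s => by
    have := (((hasDerivAt_id s).const_mul (2 * m)).const_add 2).add
      (((hasDerivAt_id s).pow 2).const_mul (m * (m + 1)))
    refine this.congr_deriv ?_
    simp [N']; ring
  have dN' : ∀ s, HasDerivAt N' (2 * m * (m + 1)) s := fun s => by
    have := ((hasDerivAt_id s).const_mul (2 * m * (m + 1))).const_add (2 * m)
    exact this.congr_deriv (by simp)
  have dy : ∀ s, HasDerivAt y m s := fun s => by
    have := ((hasDerivAt_id s).const_mul m).const_add 1
    exact this.congr_deriv (by simp)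
  have cN : Continuous N := by fun_prop
  have cN' : Continuous N' := by fun_prop
  have cy : Continuous y := by fun_prop
  have clogN : ContinuousOn (fun s => Real.log (N s)) (Set.Icc 0 1) :=
    cN.continuousOn.log fun s hs => (hN s hs.1).ne'
  have clogy : ContinuousOn (fun s => Real.log (y s)) (Set.Icc 0 1) :=
    cy.continuousOn.log fun s hs => (hy s hs.1).ne'
  have csl : Continuous fun s : ℝ => s * Real.log s := Real.continuous_mul_log
  have key := nonneg_of_third_deriv_sign
    (G := fun s => N s * Real.log (N s) - 2 * y s ^ 2 * Real.log (y s)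
      - 2 * m * s * (s * Real.log s) - (N s * e + κ * s ^ 2))
    (G₁ := fun s => N' s * (Real.log (N s) + 1) - 2 * m * (2 * y s * Real.log (y s) + y s)
      - 2 * m * (2 * (s * Real.log s) + s) - (N' s * e + 2 * κ * s))
    (G₂ := fun s => 2 * m * (m + 1) * (Real.log (N s) + 1) + N' s ^ 2 / N s
      - 2 * m ^ 2 * (2 * Real.log (y s) + 3)
      - 2 * m * (2 * Real.log s + 3) - (2 * m * (m + 1) * e + 2 * κ))
    (G₃ := fun s => 6 * m * (m + 1) * N' s / N s - N' s ^ 3 / N s ^ 2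
      - 4 * m ^ 3 / y s - 4 * m / s)
    (by fun_prop) (by fun_prop) ?_ ?_ ?_ ?_ ?_ ?_ ?_ ?_ hs
  · simp only [N, y] at key
    nlinarith [mul_nonneg hκ0 (sq_nonneg s)]
  · intro x hx
    have hNx := (hN x hx.1.le).ne'
    have hyx := (hy x hx.1.le).ne'
    have hx0 := hx.1.ne'
    have := ((((dN x).mul ((dN x).log hNx)).sub
      ((((dy x).pow 2).const_mul 2).mul ((dy x).log hyx))).sub
      (((hasDerivAt_id x).const_mul (2 * m)).mul
        ((hasDerivAt_id x).mul ((hasDerivAt_id x).log hx0)))).sub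
      (((dN x).mul_const e).add (((hasDerivAt_id x).pow 2).const_mul κ))
    refine this.congr_deriv ?_
    simp only [id]
    field_simp
    simp
    ring
  · intro x hx
    have hNx := (hN x hx.1.le).ne'
    have hyx := (hy x hx.1.le).ne'
    have hx0 := hx.1.ne'
    have := ((((dN' x).mul (((dN x).log hNx).add_const 1)).sub
      (((((dy x).const_mul 2).mul ((dy x).log hyx)).add (dy x)).const_mul (2 * m))).sub
      (((((hasDerivAt_id x).mul ((hasDerivAt_id x).log hx0)).const_mul 2).add
        (hasDerivAt_id x)).const_mul (2 * m))).sub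
      (((dN' x).mul_const e).add ((hasDerivAt_id x).const_mul (2 * κ)))
    refine this.congr_deriv ?_
    simp only [id]
    field_simp
    ring
  · intro x hx
    have hNx := (hN x hx.1.le).ne'
    have hyx := (hy x hx.1.le).ne'
    have hx0 := hx.1.ne'
    have := (((((((dN x).log hNx).add_const 1).const_mul (2 * m * (m + 1))).add
      (((dN' x).pow 2).div (dN x) hNx)).sub
      (((((dy x).log hyx).const_mul 2).add_const 3).const_mul (2 * m ^ 2))).sub
      (((((hasDerivAt_id x).log hx0).const_mul 2).add_const 3).const_mul (2 * m))).sub_const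
        (2 * m * (m + 1) * e + 2 * κ)
    refine this.congr_deriv ?_
    simp only [id, Pi.pow_apply]
    field_simp
    simp
    ring
  · have hG₃ : ∀ x, 0 < x → 6 * m * (m + 1) * N' x / N x - N' x ^ 3 / N x ^ 2
        - 4 * m ^ 3 / y x - 4 * m / x = 4 * m * x / (N x ^ 2 * y x) *
        (m ^ 2 * (m + 1) ^ 2 * x + 2 * m * (m ^ 2 + m + 1) - 6 * m / x - 4 / x ^ 2) := by
      intro x hx
      have hNx := (hN x hx.le).ne'
      have hyx := (hy x hx.le).ne'
      field_simp
      simp only [N, N', y]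
      ring
    intro x z hx hxz hz hpos
    have hz0 := hx.trans hxz
    have hNx := hN x hx.le
    have hyx := hy x hx.le
    have hNz := hN z hz0.le
    have hyz := hy z hz0.le
    rw [hG₃ x hx] at hpos
    rw [hG₃ z hz0]
    have h1 := (pos_iff_pos_of_mul_pos hpos).1 (by positivity)
    refine mul_nonneg (by positivity) (h1.le.trans ?_)
    gcongr
  · simp [N, y]; linarith
  · simp [N, N', y]; nlinarith
  · have h1 : N 1 = (m + 1) * (m + 2) := by simp only [N]; ring
    have h2 : y 1 = m + 1 := by simp only [y]; ring
    simp only [h1, h2]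
    rw [Real.log_mul (by positivity) (by positivity), hκ, hE]
    simp
    apply le_of_eq
    field_simp
    ring
  · have h1 : N 1 = (m + 1) * (m + 2) := by simp only [N]; ring
    have h2 : y 1 = m + 1 := by simp only [y]; ring
    have h3 : N' 1 = 2 * m * (m + 2) := by simp only [N']; ring
    simp only [h1, h2, h3]
    rw [Real.log_mul (by positivity) (by positivity)]
    have : Real.log (m + 2) = E + m / (m + 2) * Real.log (m + 1) := by linarith
    rw [this, hκ]
    have h4 : 0 ≤ (m + 2) * (E - e) := mul_nonneg (by positivity) (sub_nonneg.2 heE)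
    simp
    field_simp
    nlinarith

/-- Hermite interpolation of `y² log y²` by a quadratic touching it at `B` and meeting it at `C`
bounds it from above on `[-C, C]`. -/
lemma exists_quadratic_majorant {B C : ℝ} (hB : 0 < B) (hBC : B < C) :
    ∃ α β γ : ℝ, B ^ 2 * Real.log (B ^ 2) = α + β * B + γ * B ^ 2 ∧
      C ^ 2 * Real.log (C ^ 2) = α + β * C + γ * C ^ 2 ∧
      ∀ y, |y| ≤ C → y ^ 2 * Real.log (y ^ 2) ≤ α + β * y + γ * y ^ 2 := by
  obtain ⟨γ, hγ⟩ : ∃ γ : ℝ, 2 * C ^ 2 * Real.log C - 2 * B ^ 2 * Real.log B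
      - (4 * B * Real.log B + 2 * B) * (C - B) = γ * (C - B) ^ 2 :=
    ⟨_, (div_mul_cancel₀ _ (pow_ne_zero 2 (sub_pos.2 hBC).ne')).symm⟩
  obtain ⟨β, hβ⟩ : ∃ β : ℝ, β = 4 * B * Real.log B + 2 * B - 2 * γ * B := ⟨_, rfl⟩
  obtain ⟨α, hα⟩ : ∃ α : ℝ, α = 2 * B ^ 2 * Real.log B - β * B - γ * B ^ 2 := ⟨_, rfl⟩
  let g : ℝ → ℝ := fun y => 2 * y * (y * Real.log y) - (α + β * y + γ * y ^ 2)
  let g₁ : ℝ → ℝ := fun y => 4 * (y * Real.log y) + 2 * y - (β + 2 * γ * y)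
  let g₂ : ℝ → ℝ := fun y => 4 * Real.log y + 6 - 2 * γ
  have csl : Continuous fun s : ℝ => s * Real.log s := Real.continuous_mul_log
  have cg : Continuous g := by fun_prop
  have cg₁ : Continuous g₁ := by fun_prop
  have dg : ∀ x, 0 < x → HasDerivAt g (g₁ x) x := by
    intro x hx
    have := (((hasDerivAt_id x).const_mul 2).mul
      ((hasDerivAt_id x).mul ((hasDerivAt_id x).log hx.ne'))).sub
      ((((hasDerivAt_id x).const_mul β).const_add α).add (((hasDerivAt_id x).pow 2).const_mul γ))
    refine this.congr_deriv ?_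
    simp only [id, g₁]
    field_simp
    simp
    ring
  have dg₁ : ∀ x, 0 < x → HasDerivAt g₁ (g₂ x) x := by
    intro x hx
    have := ((((hasDerivAt_id x).mul ((hasDerivAt_id x).log hx.ne')).const_mul 4).add
      ((hasDerivAt_id x).const_mul 2)).sub
      (((hasDerivAt_id x).const_mul (2 * γ)).const_add β)
    refine this.congr_deriv ?_
    simp only [id, g₂]
    field_simp
    ring
  have mono₂ : ∀ u v, 0 < u → u < v → g₂ u < g₂ v := fun u v hu huv => by
    have := Real.log_lt_log hu huv
    simp only [g₂]; linarith
  have mvt : ∀ {f f' : ℝ → ℝ}, Continuous f → (∀ x, 0 < x → HasDerivAt f (f' x) x) →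
      ∀ u v : ℝ, 0 ≤ u → u < v → ∃ c, u < c ∧ c < v ∧ f' c * (v - u) = f v - f u := by
    intro f f' hf hf' u v hu huv
    obtain ⟨c, hc, h⟩ := exists_hasDerivAt_eq_slope f f' huv hf.continuousOn
      (fun x hx => hf' x (hu.trans_lt hx.1))
    exact ⟨c, hc.1, hc.2, by rw [h]; field_simp [(sub_pos.2 huv).ne']⟩
  have gB : g B = 0 := by simp only [g, hα]; ring
  have g₁B : g₁ B = 0 := by simp only [g₁, hβ]; ring
  have gC : g C = 0 := by
    simp only [g]; rw [hα, hβ]; linear_combination hγ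
  obtain ⟨c, hBc, hcC, hc⟩ := mvt cg dg B C hB.le hBC
  have hc0 : g₁ c = 0 := by
    rw [gB, gC, sub_zero] at hc
    exact (mul_eq_zero.1 hc).resolve_right (sub_pos.2 hBC).ne'
  obtain ⟨ξ, hBξ, hξc, hξ⟩ := mvt cg₁ dg₁ B c hB.le hBc
  have hξ0 : g₂ ξ = 0 := by
    rw [g₁B, hc0, sub_zero] at hξ
    exact (mul_eq_zero.1 hξ).resolve_right (sub_pos.2 hBc).ne'
  have hβ0 : β ≤ 0 := by
    have h := mono₂ B ξ hB hBξ
    rw [hξ0] at h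
    simp only [g₂] at h
    rw [hβ]
    nlinarith
  have gle : ∀ y, 0 ≤ y → y ≤ C → g y ≤ 0 := by
    intro y hy0 hyC
    by_contra! hpos
    rcases lt_trichotomy y B with h | h | h
    · obtain ⟨p, hyp, hpB, hp⟩ := mvt cg dg y B hy0 h
      have hp' : g₁ p < 0 := by
        by_contra! h'
        linarith [mul_nonneg h' (sub_nonneg.2 h.le)]
      obtain ⟨q, hpq, hqB, hq⟩ := mvt cg₁ dg₁ p B (by linarith) hpB
      have hq' := mono₂ q ξ (by linarith) (by linarith)
      rw [hξ0] at hq'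
      linarith [mul_nonneg (sub_nonneg.2 hq'.le) (sub_nonneg.2 hpB.le)]
    · rw [h] at hpos; linarith
    · have hyC' : y < C := lt_of_le_of_ne hyC (by rintro rfl; linarith)
      obtain ⟨p, hBp, hpy, hp⟩ := mvt cg dg B y hB.le h
      obtain ⟨q, hyq, hqC, hq⟩ := mvt cg dg y C hy0 hyC'
      have hp' : 0 < g₁ p := by
        by_contra! h'
        linarith [mul_nonneg (neg_nonneg.2 h') (sub_nonneg.2 h.le)]
      have hq' : g₁ q < 0 := by
        by_contra! h'
        linarith [mul_nonneg h' (sub_nonneg.2 hyC)]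
      obtain ⟨u, hBu, hup, hu⟩ := mvt cg₁ dg₁ B p hB.le hBp
      obtain ⟨v, hpv, hvq, hv⟩ := mvt cg₁ dg₁ p q (by linarith) (by linarith)
      have hu' : 0 < g₂ u := by
        by_contra! h'
        linarith [mul_nonneg (neg_nonneg.2 h') (sub_nonneg.2 hBp.le)]
      have hv' := mono₂ u v (by linarith) (by linarith)
      linarith [mul_nonneg (hu'.trans hv').le (sub_nonneg.2 (hpv.trans hvq).le)]
  refine ⟨α, β, γ, ?_, ?_, ?_⟩
  · rw [Real.log_pow]; push_cast; simp only [g] at gB; linarith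
  · rw [Real.log_pow]; push_cast; simp only [g] at gC; linarith
  · intro y hy
    have h := gle |y| (abs_nonneg y) hy
    have h2 : β * |y| ≤ β * y := mul_le_mul_of_nonpos_left (le_abs_self y) hβ0
    have h3 : 2 * |y| * (|y| * Real.log |y|) = y ^ 2 * Real.log (y ^ 2) := by
      rw [Real.log_pow, Real.log_abs]; push_cast; rw [← sq_abs y]; ring
    simp only [g] at h
    rw [h3, sq_abs] at h
    linarith

/-- The sum of `y² log y²` over `m + 1` reals with prescribed sum and sum of squares is largest
when all but the largest of them coincide. -/
lemma sum_sq_mul_log_sq_le {ι : Type*} [DecidableEq ι] {S : Finset ι} {y : ι → ℝ} {m B C : ℝ}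
    (hm : 1 ≤ m) (hcard : (S.card : ℝ) = m + 1) (hB : 0 < B) (hBC : B ≤ C)
    (hsum : ∑ j ∈ S, y j = C + m * B) (hsq : ∑ j ∈ S, y j ^ 2 = C ^ 2 + m * B ^ 2) :
    ∑ j ∈ S, y j ^ 2 * Real.log (y j ^ 2) ≤
      C ^ 2 * Real.log (C ^ 2) + m * (B ^ 2 * Real.log (B ^ 2)) := by
  rcases hBC.eq_or_lt with rfl | hlt
  · have h0 : ∑ j ∈ S, (y j - B) ^ 2 = 0 := by
      have : ∀ j ∈ S, (y j - B) ^ 2 = y j ^ 2 - 2 * B * y j + B ^ 2 := fun j _ => by ring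
      rw [Finset.sum_congr rfl this, Finset.sum_add_distrib, Finset.sum_sub_distrib,
        ← Finset.mul_sum, hsum, hsq, Finset.sum_const, nsmul_eq_mul, hcard]
      ring
    have h1 := (Finset.sum_eq_zero_iff_of_nonneg fun j _ => sq_nonneg (y j - B)).1 h0
    have h2 : ∀ j ∈ S, y j ^ 2 * Real.log (y j ^ 2) = B ^ 2 * Real.log (B ^ 2) := fun j hj => by
      rw [sub_eq_zero.1 (pow_eq_zero_iff two_ne_zero |>.1 (h1 j hj))]
    rw [Finset.sum_congr rfl h2, Finset.sum_const, nsmul_eq_mul, hcard]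
    linarith
  · obtain ⟨α, β, γ, hqB, hqC, hq⟩ := exists_quadratic_majorant hB hlt
    have habs : ∀ j ∈ S, |y j| ≤ C := by
      intro j hj
      have hc := sq_sum_le_card_mul_sum_sq (s := S.erase j) (f := y)
      have e1 : ∑ k ∈ S.erase j, y k = C + m * B - y j := by
        rw [← hsum, ← Finset.add_sum_erase S y hj]; ring
      have e2 : ∑ k ∈ S.erase j, y k ^ 2 = C ^ 2 + m * B ^ 2 - y j ^ 2 := by
        rw [← hsq, ← Finset.add_sum_erase S (fun k => y k ^ 2) hj]; ring
      have e3 : ((S.erase j).card : ℝ) = m := by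
        have := Finset.card_erase_add_one hj
        have h' : ((S.erase j).card : ℝ) + 1 = S.card := by exact_mod_cast this
        linarith
      rw [e1, e2, e3] at hc
      have hfac : (y j - C) * ((m + 1) * (y j - C) + 2 * m * (C - B)) ≤ 0 := by nlinarith
      have hpos : 0 < 2 * m * (C - B) := mul_pos (by linarith) (by linarith)
      have hle : y j ≤ C := by
        by_contra! h
        have := mul_pos (sub_pos.2 h)
          (add_pos (mul_pos (by linarith : 0 < m + 1) (sub_pos.2 h)) hpos)
        linarith
      refine abs_le.2 ⟨?_, hle⟩
      by_contra! h
      have h1 : (m + 1) * (y j - C) + 2 * m * (C - B) < 0 := by nlinarith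
      have := mul_pos_of_neg_of_neg (by linarith : y j - C < 0) h1
      linarith
    calc ∑ j ∈ S, y j ^ 2 * Real.log (y j ^ 2)
        ≤ ∑ j ∈ S, (α + β * y j + γ * y j ^ 2) :=
          Finset.sum_le_sum fun j hj => hq _ (habs j hj)
      _ = C ^ 2 * Real.log (C ^ 2) + m * (B ^ 2 * Real.log (B ^ 2)) := by
          rw [Finset.sum_add_distrib, Finset.sum_add_distrib, ← Finset.mul_sum, ← Finset.mul_sum,
            hsum, hsq, Finset.sum_const, nsmul_eq_mul, hcard, hqB, hqC]
          ring

/-- The entropy bound for the unit vectors `(C + m B, -C, -B, …, -B)`, with `m` entries equal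
to `-B`. -/
lemma three_value_entropy_bound {m e E B C : ℝ} (hm : 1 ≤ m) (he : e ≤ Real.log 2) (heE : e ≤ E)
    (hE : E = Real.log (m + 2) - m / (m + 2) * Real.log (m + 1)) (hB : 0 < B) (hBC : B ≤ C)
    (hnorm : (C + m * B) ^ 2 + C ^ 2 + m * B ^ 2 = 1) :
    (C + m * B) ^ 2 * Real.log ((C + m * B) ^ 2) + C ^ 2 * Real.log (C ^ 2)
      + m * (B ^ 2 * Real.log (B ^ 2)) ≤ -e := by
  have hC : 0 < C := hB.trans_le hBC
  obtain ⟨s, rfl⟩ : ∃ s, B = C * s := ⟨B / C, by field_simp⟩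
  have hs0 : 0 < s := pos_of_mul_pos_right hB hC.le
  have hs1 : s ≤ 1 := by nlinarith
  have key := entropy_curve_bound hm he heE hE ⟨hs0.le, hs1⟩
  set N := 2 + 2 * m * s + m * (m + 1) * s ^ 2 with hN
  have hNpos : 0 < N := by positivity
  have hNC : C ^ 2 * N = 1 := by rw [hN]; linear_combination hnorm
  have hy : 0 < 1 + m * s := by positivity
  have hlog : Real.log N = -(2 * Real.log C) := by
    have h := Real.log_mul (pow_ne_zero 2 hC.ne') hNpos.ne'
    rw [hNC, Real.log_one, Real.log_pow] at h
    push_cast at h; linarith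
  have e1 : C + m * (C * s) = C * (1 + m * s) := by ring
  rw [e1, Real.log_pow, Real.log_pow, Real.log_pow, Real.log_mul hC.ne' hy.ne',
    Real.log_mul hC.ne' hs0.ne']
  rw [hlog] at key
  have h := mul_le_mul_of_nonneg_left key (sq_nonneg C)
  have h4 : C ^ 2 * (N * e) = e := by rw [← mul_assoc, hNC, one_mul]
  rw [h4] at h
  refine le_neg_of_le_neg (h.trans (le_of_eq ?_))
  rw [hN]
  push_cast
  ring

lemma neg_sum_sq_mul_log_sq_ge {d : ℕ} (hd : 3 ≤ d) {e : ℝ} (he : e ≤ Real.log 2)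
    (heE : e ≤ Real.log d - ((d - 2 : ℝ) / d) * Real.log (d - 1)) {x : Fin d → ℝ}
    (hsq : ∑ i, x i ^ 2 = 1) (hsum : ∑ i, x i = 0) :
    e ≤ -∑ i, x i ^ 2 * Real.log (x i ^ 2) := by
  by_cases hsmall : ∀ i, x i ^ 2 ≤ 1 / 2
  · refine he.trans (le_neg_of_le_neg ?_)
    calc ∑ i, x i ^ 2 * Real.log (x i ^ 2) ≤ ∑ i, x i ^ 2 * (-Real.log 2) := by
          refine Finset.sum_le_sum fun i _ => ?_
          rcases eq_or_ne (x i) 0 with h | h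
          · simp [h]
          · have hp : 0 < x i ^ 2 := by positivity
            have := Real.log_le_log hp (hsmall i)
            rw [one_div, Real.log_inv] at this
            exact mul_le_mul_of_nonneg_left this hp.le
      _ = -Real.log 2 := by rw [← Finset.sum_mul, hsq, one_mul]
  push Not at hsmall
  obtain ⟨i, hi⟩ := hsmall
  wlog hpos : 0 < x i generalizing x
  · have := @this (fun j => -x j) (by simpa using hsq) (by simpa using hsum) (by simpa using hi)
      (by
        have : x i ≠ 0 := by rintro h; norm_num [h] at hi
        have := lt_of_le_of_ne (not_lt.1 hpos) this
        simpa using this)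
    simpa using this
  have hd' : (3 : ℝ) ≤ d := by exact_mod_cast hd
  obtain ⟨m, hm⟩ : ∃ m : ℝ, m = d - 2 := ⟨_, rfl⟩
  have hm1 : 1 ≤ m := by linarith
  have s1 : ∑ j ∈ Finset.univ.erase i, -x j = x i := by
    have := Finset.add_sum_erase Finset.univ x (Finset.mem_univ i)
    rw [Finset.sum_neg_distrib]; linarith
  have s2 : ∑ j ∈ Finset.univ.erase i, (-x j) ^ 2 = 1 - x i ^ 2 := by
    have := Finset.add_sum_erase Finset.univ (fun j => x j ^ 2) (Finset.mem_univ i)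
    simp only [neg_sq]; linarith
  have hcard : ((Finset.univ.erase i).card : ℝ) = m + 1 := by
    rw [Finset.card_erase_of_mem (Finset.mem_univ i), Finset.card_univ, Fintype.card_fin,
      Nat.cast_sub (by omega)]
    push_cast; linarith
  have hcs := sq_sum_le_card_mul_sum_sq (s := Finset.univ.erase i) (f := fun j => -x j)
  rw [s1, s2, hcard] at hcs
  obtain ⟨w, hw0, hw⟩ : ∃ w : ℝ, 0 ≤ w ∧ m * w ^ 2 = (m + 1) * (1 - x i ^ 2) - x i ^ 2 := by
    refine ⟨√(((m + 1) * (1 - x i ^ 2) - x i ^ 2) / m), Real.sqrt_nonneg _, ?_⟩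
    rw [Real.sq_sqrt (div_nonneg (by linarith) (by linarith))]
    field_simp
  have hwt : w < x i := by
    refine lt_of_pow_lt_pow_left₀ 2 hpos.le ?_
    have : m * w ^ 2 < m * x i ^ 2 := by rw [hw]; nlinarith
    exact lt_of_mul_lt_mul_left this (by linarith)
  obtain ⟨B, hB⟩ : ∃ B : ℝ, B = (x i - w) / (m + 1) := ⟨_, rfl⟩
  have hB0 : 0 < B := by rw [hB]; exact div_pos (by linarith) (by linarith)
  have hBw : x i = w + (m + 1) * B := by rw [hB]; field_simp; ring
  have ht : x i = (B + w) + m * B := by rw [hBw]; ring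
  have hq : 1 - x i ^ 2 = (B + w) ^ 2 + m * B ^ 2 := by
    have h1 : (m + 1) * (1 - x i ^ 2) = (m + 1) * ((B + w) ^ 2 + m * B ^ 2) := by
      have : (m + 1) * (1 - x i ^ 2) = m * w ^ 2 + x i ^ 2 := by linarith
      rw [this, hBw]; ring
    exact mul_left_cancel₀ (by positivity) h1
  have main := sum_sq_mul_log_sq_le hm1 hcard hB0 (by linarith : B ≤ B + w)
    (s1.trans ht) (s2.trans hq)
  have hfin := three_value_entropy_bound hm1 he heE
    (by rw [hm]; congr 2 <;> ring_nf) hB0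
    (by linarith : B ≤ B + w) (by rw [← ht]; linarith)
  rw [← ht] at hfin
  rw [← Finset.add_sum_erase Finset.univ _ (Finset.mem_univ i)]
  simp only [neg_sq] at main
  linarith

lemma three_mul_mul_pred_le_two_pow {d : ℕ} (hd : 7 ≤ d) : (3 * d * (d - 1) : ℝ) ≤ 2 ^ d := by
  induction d, hd using Nat.le_induction with
  | base => norm_num
  | succ k hk ih =>
    have : (7 : ℝ) ≤ k := by exact_mod_cast hk
    rw [pow_succ]
    push_cast
    nlinarith

lemma log_sub_mul_log_pred_le_log_two {d : ℕ} (hd : 7 ≤ d) :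
    Real.log d - ((d - 2 : ℝ) / d) * Real.log (d - 1) ≤ Real.log 2 := by
  have hd' : (7 : ℝ) ≤ d := by exact_mod_cast hd
  have h1 := Real.log_le_log (by nlinarith) (three_mul_mul_pred_le_two_pow hd)
  rw [Real.log_mul (by positivity) (by linarith), Real.log_mul (by norm_num) (by positivity),
    Real.log_pow] at h1
  have h2 : Real.log d - Real.log (d - 1) ≤ 1 / (d - 1) := by
    rw [← Real.log_div (by positivity) (by linarith)]
    refine (Real.log_le_sub_one_of_pos (div_pos (by linarith) (by linarith))).trans (le_of_eq ?_)
    have : (d - 1 : ℝ) ≠ 0 := by linarith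
    field_simp
    ring
  have h3 : (1 : ℝ) ≤ Real.log 3 := by
    rw [Real.le_log_iff_exp_le (by norm_num)]
    linarith [Real.exp_one_lt_d9]
  have h4 : (d - 1) * (Real.log d - Real.log (d - 1)) ≤ 1 := by
    rwa [le_div_iff₀ (by linarith), mul_comm] at h2
  have h5 : ((d - 2 : ℝ) / d) * Real.log (d - 1) = (d - 2) * Real.log (d - 1) / d := by ring
  rw [h5, sub_le_iff_le_add, ← sub_le_iff_le_add', le_div_iff₀ (by linarith)]
  linarith

lemma log_two_le_log_sub_mul_log_pred {d : ℕ} (hd : 3 ≤ d) (hd6 : d ≤ 6) :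
    Real.log 2 ≤ Real.log d - ((d - 2 : ℝ) / d) * Real.log (d - 1) := by
  have aux : (d - 1 : ℝ) ^ (d - 2) * 2 ^ d ≤ (d : ℝ) ^ d := by
    interval_cases d <;> norm_num
  have hd' : (3 : ℝ) ≤ d := by exact_mod_cast hd
  have hp : (0 : ℝ) < d - 1 := by linarith
  have h := Real.log_le_log (by positivity) aux
  rw [Real.log_mul (by positivity) (by positivity), Real.log_pow, Real.log_pow, Real.log_pow,
    Nat.cast_sub (by omega)] at h
  push_cast at h
  have h5 : ((d - 2 : ℝ) / d) * Real.log (d - 1) = (d - 2) * Real.log (d - 1) / d := by ring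
  rw [h5, le_sub_iff_add_le, ← le_sub_iff_add_le', div_le_iff₀ (by linarith)]
  linarith

lemma exists_entropy_eq_log_two {d : ℕ} (hd : 2 ≤ d) :
    ∃ x : Fin d → ℝ, ∑ i, x i ^ 2 = 1 ∧ ∑ i, x i = 0 ∧
      Real.log 2 = -∑ i, x i ^ 2 * Real.log (x i ^ 2) := by
  obtain ⟨k, rfl⟩ := Nat.exists_eq_add_of_le' hd
  have h : (√(1 / 2 : ℝ)) ^ 2 = 1 / 2 := Real.sq_sqrt (by norm_num)
  refine ⟨Fin.cons (√(1 / 2)) (Fin.cons (-√(1 / 2)) fun _ => 0), ?_, ?_, ?_⟩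
  · simp only [Fin.sum_univ_succ, Fin.cons_zero, Fin.cons_succ, neg_sq, h]; norm_num
  · simp [Fin.sum_univ_succ]
  · simp only [Fin.sum_univ_succ, Fin.cons_zero, Fin.cons_succ, neg_sq, h]
    rw [one_div, Real.log_inv]; simp; ring

lemma exists_entropy_eq_log_sub {d : ℕ} (hd : 2 ≤ d) :
    ∃ x : Fin d → ℝ, ∑ i, x i ^ 2 = 1 ∧ ∑ i, x i = 0 ∧
      Real.log d - ((d - 2 : ℝ) / d) * Real.log (d - 1) =
        -∑ i, x i ^ 2 * Real.log (x i ^ 2) := by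
  obtain ⟨k, rfl⟩ := Nat.exists_eq_add_of_le' hd
  obtain ⟨n, hn⟩ : ∃ n : ℝ, n = k + 1 := ⟨_, rfl⟩
  have hn0 : 0 < n := by rw [hn]; positivity
  obtain ⟨b, hb⟩ : ∃ b : ℝ, b ^ 2 = 1 / (n * (n + 1)) :=
    ⟨√(1 / (n * (n + 1))), Real.sq_sqrt (by positivity)⟩
  have e1 : (n * b) ^ 2 = n / (n + 1) := by rw [mul_pow, hb]; field_simp
  have e2 : ((k + 2 : ℕ) : ℝ) = n + 1 := by rw [hn]; push_cast; ring
  refine ⟨Fin.cons (n * b) fun _ => -b, ?_, ?_, ?_⟩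
  · simp only [Fin.sum_univ_succ (n := k + 1), Fin.cons_zero, Fin.cons_succ, neg_sq, e1, hb,
      Finset.sum_const, Finset.card_univ, Fintype.card_fin, nsmul_eq_mul]
    push_cast; rw [← hn]; field_simp
  · simp only [Fin.sum_univ_succ (n := k + 1), Fin.cons_zero, Fin.cons_succ,
      Finset.sum_const, Finset.card_univ, Fintype.card_fin, nsmul_eq_mul]
    push_cast; rw [← hn]; ring
  · simp only [Fin.sum_univ_succ (n := k + 1), Fin.cons_zero, Fin.cons_succ, neg_sq, e1, hb,
      Finset.sum_const, Finset.card_univ, Fintype.card_fin, nsmul_eq_mul]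
    rw [e2, Real.log_div hn0.ne' (by positivity), one_div, Real.log_inv,
      Real.log_mul hn0.ne' (by positivity)]
    push_cast
    rw [← hn, add_sub_cancel_right]
    field_simp
    ring

/-- For `d ≥ 3`, the minimum of the Shannon entropy `H(P_x) = -∑_i x_i² log(x_i²)`
over unit vectors `x ∈ ℝ^d` with zero sum equals `log 2` for `3 ≤ d ≤ 6` and
`log d - ((d-2)/d) log(d-1)` for `d ≥ 7`. -/
theorem min_shannon_entropy (d : ℕ) (hd : 3 ≤ d) :
    IsLeast { h : ℝ | ∃ x : Fin d → ℝ, (∑ i, (x i) ^ 2) = 1 ∧ (∑ i, x i) = 0 ∧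
        h = -∑ i, (x i) ^ 2 * Real.log ((x i) ^ 2) }
      (if d ≤ 6 then Real.log 2
       else Real.log d - ((d - 2 : ℝ) / d) * Real.log (d - 1)) := by
  split_ifs with h6
  · refine ⟨exists_entropy_eq_log_two (by omega), ?_⟩
    rintro _ ⟨x, hsq, hsum, rfl⟩
    exact neg_sum_sq_mul_log_sq_ge hd le_rfl (log_two_le_log_sub_mul_log_pred hd h6) hsq hsum
  · refine ⟨exists_entropy_eq_log_sub (by omega), ?_⟩
    rintro _ ⟨x, hsq, hsum, rfl⟩
    exact neg_sum_sq_mul_log_sq_ge hd (log_sub_mul_log_pred_le_log_two (by omega)) le_rfl hsq hsum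
end

section
/- Let d ≥ 3, 1 < p < 2, and let x ∈ ℝ^d satisfy ∑_{i=1}^d x_i = 0 and ∑_{i=1}^d x_i² = 1. Suppose there exist λ, μ ∈ ℝ such that p|x_i|^{p−2} x_i = λ + 2μ x_i for all 1 ≤ i ≤ d (with the convention |0|^{p−2}·0 = 0). Then μ > 0; moreover, if λ = 0 then F(x) := ∑_{i=1}^d |x_i|^p ≥ 2^{1−p/2}, with equality exactly when x equals, up to a permutation of coordinates and a global sign, the vector (1/√2)(1, −1, 0, …, 0). -/
theorem abs_rpow_eq_abs_rpow_sub_two_mul_mul {p : ℝ} (hp : p ≠ 0) (t : ℝ) :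
    |t| ^ p = |t| ^ (p - 2) * t * t := by
  rcases eq_or_ne t 0 with rfl | ht
  · simp [Real.zero_rpow hp]
  · rw [mul_assoc, ← pow_two, ← sq_abs, ← Real.rpow_natCast, ← Real.rpow_add (abs_pos.2 ht)]
    norm_num

theorem abs_rpow_sub_two_eq {t : ℝ} (p : ℝ) :
    |t| ^ (p - 2) = ((t ^ 2)⁻¹) ^ (1 - p / 2) := by
  rw [← Real.rpow_neg_eq_inv_rpow, ← sq_abs, ← Real.rpow_natCast, ← Real.rpow_mul (abs_nonneg t)]
  congr 1
  push_cast
  ring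

theorem Equiv.Perm.exists_apply_eq_apply_eq {α : Type*} [DecidableEq α] {i j a b : α}
    (hij : i ≠ j) (hab : a ≠ b) : ∃ σ : Equiv.Perm α, σ i = a ∧ σ j = b := by
  have h : a ≠ Equiv.swap i a j := fun h => hij <| (Equiv.swap i a).injective <| by
    rw [Equiv.swap_apply_left]; exact h
  refine ⟨(Equiv.swap i a).trans (Equiv.swap (Equiv.swap i a j) b), ?_, ?_⟩
  · rw [Equiv.trans_apply, Equiv.swap_apply_left, Equiv.swap_apply_of_ne_of_ne h hab]
  · rw [Equiv.trans_apply, Equiv.swap_apply_left]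


/-- Lemma on Lagrange multipliers, case `1 < p < 2`: if `x` satisfies the constraints
`∑ x_i = 0`, `∑ x_i² = 1` and the Euler–Lagrange equations
`p |x_i|^(p-2) x_i = λ + 2 μ x_i`, then `μ > 0`; moreover, if `λ = 0` then
`∑ |x_i|^p ≥ 2^(1-p/2)`, with equality exactly for `(1/√2)(1,-1,0,…,0)`
up to permutation and a global sign. -/
theorem lagrange_lambda_zero_p (d : ℕ) (hd : 3 ≤ d) (p : ℝ) (hp1 : 1 < p) (hp2 : p < 2)
    (x : Fin d → ℝ) (hsum : (∑ i, x i) = 0) (hnorm : (∑ i, (x i) ^ 2) = 1)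
    (lam mu : ℝ) (hEL : ∀ i, p * |x i| ^ (p - 2) * x i = lam + 2 * mu * x i) :
    0 < mu ∧ (lam = 0 →
      ((2 : ℝ) ^ (1 - p / 2) ≤ ∑ i, |x i| ^ p ∧
        ((∑ i, |x i| ^ p) = (2 : ℝ) ^ (1 - p / 2) ↔
          ∃ σ : Equiv.Perm (Fin d), ∃ ε : ℝ, (ε = 1 ∨ ε = -1) ∧
            ∀ i, x i = ε * (if σ i = (⟨0, by omega⟩ : Fin d) then 1 / Real.sqrt 2
              else if σ i = (⟨1, by omega⟩ : Fin d) then -1 / Real.sqrt 2 else 0)))) := by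
  set F := ∑ i, |x i| ^ p with hF
  have hFmu : p * F = 2 * mu := by
    calc p * F = ∑ i, (lam * x i + 2 * mu * x i ^ 2) := by
          rw [hF, Finset.mul_sum]
          refine Finset.sum_congr rfl fun i _ => ?_
          rw [abs_rpow_eq_abs_rpow_sub_two_mul_mul (by linarith)]
          linear_combination x i * hEL i
      _ = 2 * mu := by
          rw [Finset.sum_add_distrib, ← Finset.mul_sum, ← Finset.mul_sum, hsum, hnorm]
          ring
  obtain ⟨k, hk⟩ : ∃ k, x k ≠ 0 := by
    by_contra! h
    simp [h] at hnorm
  have hFpos : 0 < F :=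
    Finset.sum_pos' (fun i _ => by positivity)
      ⟨k, Finset.mem_univ k, Real.rpow_pos_of_pos (abs_pos.2 hk) p⟩
  refine ⟨by nlinarith, fun hlam => ?_⟩
  subst hlam
  have hval : ∀ i, x i ≠ 0 → F = ((x i ^ 2)⁻¹) ^ (1 - p / 2) := by
    intro i hi
    rw [← abs_rpow_sub_two_eq]
    have h : (p * x i) * F = (p * x i) * |x i| ^ (p - 2) := by
      linear_combination x i * hFmu - hEL i
    exact mul_left_cancel₀ (mul_ne_zero (by linarith) hi) h
  have hq : 0 < 1 - p / 2 := by linarith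
  obtain ⟨i, -, hi⟩ := Finset.exists_pos_of_sum_zero_of_exists_nonzero x hsum
    ⟨k, Finset.mem_univ k, hk⟩
  obtain ⟨j, -, hj⟩ := Finset.exists_pos_of_sum_zero_of_exists_nonzero (fun i => -x i)
    (by rw [Finset.sum_neg_distrib, hsum, neg_zero]) ⟨k, Finset.mem_univ k, neg_ne_zero.2 hk⟩
  have hj : x j < 0 := neg_pos.1 hj
  have hij : i ≠ j := by rintro rfl; linarith
  have hsq : x i ^ 2 = x j ^ 2 := by
    have h := (hval i hi.ne').symm.trans (hval j hj.ne)
    rw [Real.rpow_left_inj (by positivity) (by positivity) hq.ne'] at h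
    exact inv_injective h
  have hxj : x j = -x i := by
    rcases sq_eq_sq_iff_eq_or_eq_neg.1 hsq with h | h <;> linarith
  have hpair : ∑ l ∈ {i, j}, x l ^ 2 = 2 * x i ^ 2 := by
    rw [Finset.sum_pair hij, ← hsq]; ring
  have hle : 2 * x i ^ 2 ≤ 1 := by
    rw [← hpair, ← hnorm]
    exact Finset.sum_le_sum_of_subset_of_nonneg (Finset.subset_univ _) fun _ _ _ => sq_nonneg _
  have hsqrt : (1 / Real.sqrt 2) ^ 2 = 1 / 2 := by
    rw [div_pow, Real.sq_sqrt (by norm_num), one_pow]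
  have hb : 2 ≤ (x i ^ 2)⁻¹ := by
    rw [le_inv_comm₀ (by norm_num) (by positivity)]
    linarith
  refine ⟨?_, fun h => ?_, ?_⟩
  · rw [hval i hi.ne']
    exact Real.rpow_le_rpow (by norm_num) hb hq.le
  · rw [hval i hi.ne', Real.rpow_left_inj (by positivity) (by norm_num) hq.ne'] at h
    have hhalf : x i ^ 2 = 1 / 2 := by rw [← inv_inv (x i ^ 2), h]; norm_num
    have hxi : x i = 1 / Real.sqrt 2 := by
      rw [← sq_eq_sq₀ hi.le (by positivity), hsqrt, hhalf]
    obtain ⟨σ, hσi, hσj⟩ := Equiv.Perm.exists_apply_eq_apply_eq hij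
      (show (⟨0, by omega⟩ : Fin d) ≠ ⟨1, by omega⟩ by simp)
    refine ⟨σ, 1, Or.inl rfl, fun l => ?_⟩
    rw [one_mul]
    by_cases hli : l = i
    · rw [hli, if_pos hσi, hxi]
    by_cases hlj : l = j
    · rw [hlj, if_neg (by rw [hσj]; simp), if_pos hσj, hxj, hxi, neg_div]
    rw [← hσi, ← hσj, if_neg (σ.injective.ne hli), if_neg (σ.injective.ne hlj)]
    have hl : ∑ m ∈ {l, i, j}, x m ^ 2 ≤ 1 := by
      rw [← hnorm]
      exact Finset.sum_le_sum_of_subset_of_nonneg (Finset.subset_univ _) fun _ _ _ => sq_nonneg _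
    rw [Finset.sum_insert (by simp [hli, hlj]), hpair, hhalf] at hl
    exact pow_eq_zero_iff two_ne_zero |>.1 (le_antisymm (by linarith) (sq_nonneg _))
  · rintro ⟨σ, ε, hε, hx⟩
    have hm := hx (σ.symm ⟨0, by omega⟩)
    rw [Equiv.apply_symm_apply, if_pos rfl] at hm
    have hε2 : ε ^ 2 = 1 := by rcases hε with rfl | rfl <;> norm_num
    have hm2 : x (σ.symm ⟨0, by omega⟩) ^ 2 = 1 / 2 := by
      rw [hm, mul_pow, hsqrt, hε2, one_mul]
    rw [hval (σ.symm ⟨0, by omega⟩) (fun h => by norm_num [h] at hm2), hm2]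
    norm_num
end

section
/- Let d ≥ 3 and 1 < p < 2. Suppose x ∈ ℝ^d minimizes F(x) = ∑_{i=1}^d |x_i|^p over the constraint set S, and there exist λ, μ ∈ ℝ with λ ≠ 0 such that p|x_i|^{p−2} x_i = λ + 2μ x_i for all i (with the convention |0|^{p−2}·0 = 0). Then all coordinates of x are nonzero, and after replacing x by −x if necessary and permuting coordinates, x = (a, −y_1, …, −y_{d−1}) with a > 0 and y_j > 0 for all j; that is, either x or −x has exactly one positive coordinate and all remaining coordinates strictly negative. -/
/-- Replacing two equal entries `a, a` of a vector by `2 * a, 0` changes a separable sum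
only in these two entries. -/
lemma sum_update_merge {ι : Type*} [Fintype ι] [DecidableEq ι] (x : ι → ℝ) {j k : ι}
    (hjk : j ≠ k) (heq : x k = x j) (f : ℝ → ℝ) :
    ∑ i, f (Function.update (Function.update x k 0) j (2 * x j) i) =
      ∑ i, f (x i) + (f (2 * x j) + f 0 - 2 * f (x j)) := by
  have h : ∑ i, (f (Function.update (Function.update x k 0) j (2 * x j) i) - f (x i)) =
      (f (2 * x j) - f (x j)) + (f 0 - f (x k)) := by
    rw [Fintype.sum_eq_add j k hjk]
    · simp [Function.update_of_ne hjk.symm]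
    · rintro i ⟨hij, hik⟩
      simp [Function.update_of_ne hij, Function.update_of_ne hik]
  rw [Finset.sum_sub_distrib, heq] at h
  linarith

/-- A chord bound for the concave function `u ↦ (1 + u) ^ (p / 2)` on `[0, 1]`. -/
lemma one_add_mul_le_one_add_rpow {p u : ℝ} (hp0 : 0 ≤ p) (hp2 : p ≤ 2) (hu0 : 0 ≤ u)
    (hu1 : u ≤ 1) : 1 + u * (2 ^ (p - 1) - 1) ≤ (1 + u) ^ (p / 2) := by
  have hc := (Real.concaveOn_rpow (p := p / 2) (by linarith) (by linarith)).2
    (x := 1) (by simp) (y := 2) (by simp) (sub_nonneg.2 hu1) hu0 (by ring)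
  simp only [smul_eq_mul, Real.one_rpow, mul_one] at hc
  rw [show 1 - u + u * 2 = 1 + u by ring] at hc
  have hpow : (2 : ℝ) ^ (p - 1) ≤ 2 ^ (p / 2) :=
    Real.rpow_le_rpow_of_exponent_le one_le_two (by linarith)
  nlinarith

/-- For a minimizer, the value at two equal positive coordinates `a` satisfies
`∑ |x i| ^ p ≤ a ^ (p - 2)`. -/
lemma sum_rpow_le_of_eq {ι : Type*} [Fintype ι] {p : ℝ} (hp1 : 1 < p) (hp2 : p < 2)
    {x : ι → ℝ} (hsum : ∑ i, x i = 0) (hnorm : ∑ i, x i ^ 2 = 1)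
    (hmin : ∀ y : ι → ℝ, ∑ i, y i = 0 → ∑ i, y i ^ 2 = 1 →
      ∑ i, |x i| ^ p ≤ ∑ i, |y i| ^ p)
    {j k : ι} (hjk : j ≠ k) (heq : x k = x j) (hpos : 0 < x j) :
    ∑ i, |x i| ^ p ≤ x j ^ (p - 2) := by
  classical
  set a := x j with ha
  set z := Function.update (Function.update x k 0) j (2 * a)
  have hz1 : ∑ i, z i = 0 := by
    have := sum_update_merge x hjk heq id
    simp only [id] at this
    rw [this, hsum, ← ha]
    ring
  have hz2 : ∑ i, z i ^ 2 = 1 + 2 * a ^ 2 := by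
    rw [sum_update_merge x hjk heq (· ^ 2), hnorm, ← ha]
    ring
  have hzp : ∑ i, |z i| ^ p = ∑ i, |x i| ^ p + (2 ^ p - 2) * a ^ p := by
    rw [sum_update_merge x hjk heq (|·| ^ p), ← ha]
    rw [abs_zero, Real.zero_rpow (by linarith), abs_of_pos hpos, abs_of_pos (by linarith),
      Real.mul_rpow zero_le_two hpos.le]
    ring
  have hu1 : 2 * a ^ 2 ≤ 1 := by
    have := Finset.sum_le_univ_sum_of_nonneg (s := {j, k}) fun i => sq_nonneg (x i)
    rw [Finset.sum_pair hjk, hnorm, heq] at this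
    linarith
  have hR : 0 < 1 + 2 * a ^ 2 := by positivity
  have hscale := hmin (fun i => z i / √(1 + 2 * a ^ 2))
    (by rw [← Finset.sum_div, hz1, zero_div])
    (by simp only [div_pow, Real.sq_sqrt hR.le]
        rw [← Finset.sum_div, hz2, div_self hR.ne'])
  have hroot : √(1 + 2 * a ^ 2) ^ p = (1 + 2 * a ^ 2) ^ (p / 2) := by
    rw [Real.sqrt_eq_rpow, ← Real.rpow_mul hR.le]
    ring_nf
  simp only [abs_div, abs_of_nonneg (Real.sqrt_nonneg _),
    Real.div_rpow (abs_nonneg _) (Real.sqrt_nonneg _)] at hscale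
  rw [← Finset.sum_div, hzp, hroot, le_div_iff₀ (by positivity)] at hscale
  have hchord := one_add_mul_le_one_add_rpow (by linarith) hp2.le (by positivity) hu1
  have hF : 0 ≤ ∑ i, |x i| ^ p := Finset.sum_nonneg fun i _ => by positivity
  have h2p : (2 : ℝ) ^ p = 2 * 2 ^ (p - 1) := by
    rw [Real.rpow_sub_one two_ne_zero]
    ring
  have hap : a ^ p = a ^ (p - 2) * a ^ 2 := by
    rw [← Real.rpow_natCast, ← Real.rpow_add hpos]
    norm_num
  have h2 : (1 : ℝ) < 2 ^ (p - 1) := Real.one_lt_rpow one_lt_two (by linarith)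
  have hc : 0 < 2 * a ^ 2 * (2 ^ (p - 1) - 1) := by
    have := sub_pos.2 h2
    positivity
  rw [h2p, hap] at hscale
  refine le_of_mul_le_mul_right ?_ hc
  linarith [mul_le_mul_of_nonneg_left hchord hF]

/-- The equation `p * t ^ (p - 2) * t = l + m * t` with `l < 0` and `p ≤ 2` has at most one
positive solution. -/
lemma rpow_euler_lagrange_not_lt {p l m a b : ℝ} (hp0 : 0 ≤ p) (hp2 : p ≤ 2) (hl : l < 0)
    (ha : 0 < a) (hab : a < b) (hEa : p * a ^ (p - 2) * a = l + m * a)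
    (hEb : p * b ^ (p - 2) * b = l + m * b) : False := by
  have hb := ha.trans hab
  have hmono : b ^ (p - 2) ≤ a ^ (p - 2) :=
    Real.rpow_le_rpow_of_nonpos ha hab.le (by linarith)
  have h1 := mul_le_mul_of_nonneg_left hmono (mul_nonneg hp0 (mul_pos ha hb).le)
  have h2 := mul_pos_of_neg_of_neg hl (sub_neg.2 hab)
  linarith [congrArg (b * ·) hEa, congrArg (a * ·) hEb]

/-- A minimizer whose multiplier `lam` is negative has exactly one positive coordinate. -/
lemma exists_unique_pos_of_multiplier_neg {ι : Type*} [Fintype ι] {p : ℝ} (hp1 : 1 < p)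
    (hp2 : p < 2) {x : ι → ℝ} (hsum : ∑ i, x i = 0) (hnorm : ∑ i, x i ^ 2 = 1)
    (hmin : ∀ y : ι → ℝ, ∑ i, y i = 0 → ∑ i, y i ^ 2 = 1 →
      ∑ i, |x i| ^ p ≤ ∑ i, |y i| ^ p)
    {lam mu : ℝ} (hlam : lam < 0)
    (hEL : ∀ i, p * |x i| ^ (p - 2) * x i = lam + 2 * mu * x i) (hne : ∀ i, x i ≠ 0) :
    ∃ i₀, 0 < x i₀ ∧ ∀ i, i ≠ i₀ → x i < 0 := by
  have hp0 : 0 < p := by linarith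
  have hEpos : ∀ i, 0 < x i → p * x i ^ (p - 2) * x i = lam + 2 * mu * x i := fun i hi => by
    simpa only [abs_of_pos hi] using hEL i
  have hpF : p * ∑ i, |x i| ^ p = 2 * mu := by
    have hterm : ∀ i, p * |x i| ^ p = lam * x i + 2 * mu * x i ^ 2 := fun i => by
      have : |x i| ^ p = |x i| ^ (p - 2) * x i ^ 2 := by
        rw [← sq_abs, ← Real.rpow_natCast, ← Real.rpow_add (abs_pos.2 (hne i))]
        norm_num
      rw [this]
      linear_combination x i * hEL i
    rw [Finset.mul_sum, Finset.sum_congr rfl fun i _ => hterm i, Finset.sum_add_distrib,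
      ← Finset.mul_sum, ← Finset.mul_sum, hsum, hnorm]
    ring
  obtain ⟨j, -, hj⟩ : ∃ j ∈ Finset.univ, 0 < x j := by
    refine Finset.exists_pos_of_sum_zero_of_exists_nonzero x hsum ?_
    by_contra! h
    simp [h] at hnorm
  refine ⟨j, hj, fun k hkj => ?_⟩
  by_contra! hk
  have hk : 0 < x k := lt_of_le_of_ne hk (hne k).symm
  have heq : x k = x j := by
    rcases lt_trichotomy (x k) (x j) with h | h | h
    · exact (rpow_euler_lagrange_not_lt hp0.le hp2.le hlam hk h (hEpos k hk) (hEpos j hj)).elim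
    · exact h
    · exact (rpow_euler_lagrange_not_lt hp0.le hp2.le hlam hj h (hEpos j hj) (hEpos k hk)).elim
  have hF := sum_rpow_le_of_eq hp1 hp2 hsum hnorm hmin hkj.symm heq hj
  have hlt : p * x j ^ (p - 2) < 2 * mu := by
    refine lt_of_mul_lt_mul_right ?_ hj.le
    linarith [hEpos j hj]
  linarith [mul_le_mul_of_nonneg_left hF hp0.le]


/-- Structure of minimizers, case `1 < p < 2`: if `x` minimizes `∑ |x_i|^p` over the
constraint set `S = {∑ x_i = 0, ∑ x_i² = 1}` and satisfies the Euler–Lagrange equations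
with `λ ≠ 0`, then all coordinates are nonzero and, up to a global sign, `x` has exactly
one positive coordinate, all remaining coordinates being strictly negative. -/
theorem one_positive_coordinate_p (d : ℕ) (hd : 3 ≤ d) (p : ℝ) (hp1 : 1 < p) (hp2 : p < 2)
    (x : Fin d → ℝ) (hsum : (∑ i, x i) = 0) (hnorm : (∑ i, (x i) ^ 2) = 1)
    (hmin : ∀ y : Fin d → ℝ, (∑ i, y i) = 0 → (∑ i, (y i) ^ 2) = 1 →
      (∑ i, |x i| ^ p) ≤ ∑ i, |y i| ^ p)
    (lam mu : ℝ) (hlam : lam ≠ 0)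
    (hEL : ∀ i, p * |x i| ^ (p - 2) * x i = lam + 2 * mu * x i) :
    (∀ i, x i ≠ 0) ∧
      ∃ ε : ℝ, (ε = 1 ∨ ε = -1) ∧ ∃ i₀ : Fin d,
        0 < ε * x i₀ ∧ ∀ i, i ≠ i₀ → ε * x i < 0 := by
  have hne : ∀ i, x i ≠ 0 := fun i hi => hlam (by simpa [hi] using (hEL i).symm)
  refine ⟨hne, ?_⟩
  rcases hlam.lt_or_gt with hneg | hpos
  · refine ⟨1, Or.inl rfl, ?_⟩
    simpa only [one_mul] using
      exists_unique_pos_of_multiplier_neg hp1 hp2 hsum hnorm hmin hneg hEL hne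
  · refine ⟨-1, Or.inr rfl, ?_⟩
    simp only [neg_one_mul]
    refine exists_unique_pos_of_multiplier_neg (x := fun i => -x i) (mu := mu) hp1 hp2
      (by simp [hsum]) (by simpa using hnorm) (by simpa using hmin) (neg_neg_of_pos hpos)
      (fun i => ?_) (fun i => neg_ne_zero.2 (hne i))
    rw [abs_neg]
    linear_combination -hEL i
end

section
/- Let d ≥ 3, n = d − 1, and 1 < p < 2. Suppose x ∈ ℝ^d minimizes F(x) = ∑_{i=1}^d |x_i|^p over the constraint set S, that x = (a, −y_1, …, −y_n) with a > 0 and y_j > 0 for all j, and that there exist λ, μ ∈ ℝ with λ ≠ 0 such that p|x_i|^{p−2} x_i = λ + 2μ x_i for all i. Then, after a permutation of the y_j's, (y_1, …, y_n) = (b, c, …, c) for some b ≥ c > 0; that is, the values y_1, …, y_n take at most two distinct values and the larger value occurs exactly once whenever two distinct values occur. -/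
/-- Changing two coordinates of a vector changes a coordinatewise sum by the two new terms. -/
theorem sum_comp_update_update {ι : Type*} [Fintype ι] [DecidableEq ι] {i j : ι} (hij : i ≠ j)
    (f : ℝ → ℝ) (x : ι → ℝ) (u v : ℝ) :
    ∑ k, f (Function.update (Function.update x i u) j v k) =
      ∑ k, f (x k) - f (x i) - f (x j) + f u + f v := by
  have hmem : j ∈ Finset.univ.erase i := by simp [hij.symm]
  rw [← Finset.add_sum_erase _ _ (Finset.mem_univ i), ← Finset.add_sum_erase _ _ hmem,
    ← Finset.add_sum_erase _ (fun k => f (x k)) (Finset.mem_univ i),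
    ← Finset.add_sum_erase _ (fun k => f (x k)) hmem]
  have hrest : ∑ k ∈ (Finset.univ.erase i).erase j,
      f (Function.update (Function.update x i u) j v k) =
      ∑ k ∈ (Finset.univ.erase i).erase j, f (x k) := by
    refine Finset.sum_congr rfl fun k hk => ?_
    simp only [Finset.mem_erase] at hk
    rw [Function.update_of_ne hk.1, Function.update_of_ne hk.2.1]
  rw [hrest]
  simp only [Function.update_self, Function.update_of_ne hij]
  ring

/-- The second-order condition at `t = 0` for the spherical perturbation of two equal
coordinates. -/
theorem le_of_eventually_second_variation_nonneg {b p A : ℝ} (hb : 0 < b)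
    (h : ∀ᶠ t in nhds (0 : ℝ),
      A * (1 + 2 * t ^ 2) ^ (p / 2) ≤ A + (b + t) ^ p + (b - t) ^ p - 2 * b ^ p)
    (hp : 0 < p) : A ≤ (p - 1) * b ^ (p - 2) := by
  by_contra! hlt
  set φ : ℝ → ℝ := fun t =>
    A + (b + t) ^ p + (b - t) ^ p - 2 * b ^ p - A * (1 + 2 * t ^ 2) ^ (p / 2) with hφ
  have hpos : ∀ t : ℝ, 1 + 2 * t ^ 2 ≠ 0 := fun t => by positivity
  have hderiv : deriv φ =ᶠ[nhds 0] fun t =>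
      p * (b + t) ^ (p - 1) - p * (b - t) ^ (p - 1) -
        A * (4 * t * (p / 2) * (1 + 2 * t ^ 2) ^ (p / 2 - 1)) := by
    filter_upwards [Ioo_mem_nhds (neg_lt_zero.mpr hb) hb] with t ht
    have h1 : HasDerivAt (fun t => b + t) 1 t := (hasDerivAt_id t).const_add b
    have h2 : HasDerivAt (fun t => b - t) (-1) t := (hasDerivAt_id t).const_sub b
    have h3 : HasDerivAt (fun t : ℝ => 1 + 2 * t ^ 2) (4 * t) t :=
      (((hasDerivAt_pow 2 t).const_mul 2).const_add 1).congr_deriv (by norm_num; ring)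
    have h4 := h1.rpow_const (p := p) (Or.inl (by linarith [ht.1] : (0 : ℝ) < b + t).ne')
    have h5 := h2.rpow_const (p := p) (Or.inl (by linarith [ht.2] : (0 : ℝ) < b - t).ne')
    have h6 := h3.rpow_const (p := p / 2) (Or.inl (hpos t))
    exact ((((h4.const_add A).add h5).sub_const (2 * b ^ p)).sub (h6.const_mul A)).deriv.trans
      (by ring)
  have hderiv2 : deriv (deriv φ) 0 = 2 * p * ((p - 1) * b ^ (p - 2) - A) := by
    rw [hderiv.deriv_eq]
    have h1 : HasDerivAt (fun t => b + t) 1 0 := (hasDerivAt_id (0 : ℝ)).const_add b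
    have h2 : HasDerivAt (fun t => b - t) (-1) 0 := (hasDerivAt_id (0 : ℝ)).const_sub b
    have h3 : HasDerivAt (fun t : ℝ => 1 + 2 * t ^ 2) 0 0 :=
      (((hasDerivAt_pow 2 (0 : ℝ)).const_mul 2).const_add 1).congr_deriv (by norm_num)
    have h4 := (h1.rpow_const (p := p - 1) (Or.inl (by simpa using hb.ne'))).const_mul p
    have h5 := (h2.rpow_const (p := p - 1) (Or.inl (by simpa using hb.ne'))).const_mul p
    have h6 := h3.rpow_const (p := p / 2 - 1) (Or.inl (hpos 0))
    have h7 := (((hasDerivAt_id (0 : ℝ)).const_mul 4).mul_const (p / 2)).mul h6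
    refine ((h4.sub h5).sub (h7.const_mul A)).deriv.trans ?_
    have he : p - 1 - 1 = p - 2 := by ring
    simp [he]
    ring
  have hderiv0 : deriv φ 0 = 0 := by simpa using hderiv.eq_of_nhds
  have hφ0 : φ 0 = 0 := by simp [hφ]; ring
  have hcont : ContinuousAt φ 0 := by
    have h1 : ContinuousAt (fun t : ℝ => (b + t) ^ p) 0 :=
      (by fun_prop : ContinuousAt (fun t : ℝ => b + t) 0).rpow_const (Or.inr hp.le)
    have h2 : ContinuousAt (fun t : ℝ => (b - t) ^ p) 0 :=
      (by fun_prop : ContinuousAt (fun t : ℝ => b - t) 0).rpow_const (Or.inr hp.le)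
    have h3 : ContinuousAt (fun t : ℝ => (1 + 2 * t ^ 2) ^ (p / 2)) 0 :=
      (by fun_prop : ContinuousAt (fun t : ℝ => 1 + 2 * t ^ 2) 0).rpow_const
        (Or.inr (by positivity))
    exact (((continuousAt_const.add h1).add h2).sub continuousAt_const).sub
      (continuousAt_const.mul h3)
  have hneg : deriv (deriv φ) 0 < 0 := by
    rw [hderiv2]
    exact mul_neg_of_pos_of_neg (by positivity) (by linarith)
  have hmax : IsLocalMax φ 0 := isLocalMax_of_deriv_deriv_neg hneg hderiv0 hcont
  have hzero : φ =ᶠ[nhds 0] fun _ => 0 := by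
    filter_upwards [h, hmax] with t ht hmt
    refine le_antisymm (hmt.trans_eq hφ0) ?_
    simp only [hφ]
    linarith
  have : deriv (deriv φ) 0 = 0 := by
    rw [hzero.deriv.deriv_eq]
    simp
  exact hneg.ne this

/-- A minimizer of the `p`-energy among zero-sum unit vectors with two coordinates equal to `-b`
has energy at most `(p - 1) * b ^ (p - 2)`. -/
theorem sum_abs_rpow_le_of_minimizer_of_two_eq {ι : Type*} [Fintype ι] {p b : ℝ} (hp : 0 < p)
    (hb : 0 < b) {x : ι → ℝ} (hsum : ∑ i, x i = 0) (hnorm : ∑ i, x i ^ 2 = 1)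
    (hmin : ∀ y : ι → ℝ, ∑ i, y i = 0 → ∑ i, y i ^ 2 = 1 →
      ∑ i, |x i| ^ p ≤ ∑ i, |y i| ^ p)
    {i j : ι} (hij : i ≠ j) (hi : x i = -b) (hj : x j = -b) :
    ∑ k, |x k| ^ p ≤ (p - 1) * b ^ (p - 2) := by
  classical
  refine le_of_eventually_second_variation_nonneg hb ?_ hp
  filter_upwards [Ioo_mem_nhds (neg_lt_zero.mpr hb) hb] with t ht
  set z := Function.update (Function.update x i (-(b + t))) j (-(b - t)) with hz
  have hpos : 0 < 1 + 2 * t ^ 2 := by positivity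
  set r := √(1 + 2 * t ^ 2) with hr
  have hr0 : 0 < r := Real.sqrt_pos.mpr hpos
  have hzsum : ∑ k, z k = 0 := by
    have := sum_comp_update_update hij (fun s => s) x (-(b + t)) (-(b - t))
    rw [this, hsum, hi, hj]
    ring
  have hzsq : ∑ k, z k ^ 2 = r ^ 2 := by
    have := sum_comp_update_update hij (fun s => s ^ 2) x (-(b + t)) (-(b - t))
    rw [this, hnorm, hi, hj, hr, Real.sq_sqrt hpos.le]
    ring
  have hzp : ∑ k, |z k| ^ p = ∑ k, |x k| ^ p + (b + t) ^ p + (b - t) ^ p - 2 * b ^ p := by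
    have := sum_comp_update_update hij (fun s => |s| ^ p) x (-(b + t)) (-(b - t))
    rw [this, hi, hj]
    simp only [abs_neg, abs_of_pos hb, abs_of_pos (by linarith [ht.1] : 0 < b + t),
      abs_of_pos (by linarith [ht.2] : 0 < b - t)]
    ring
  have hle := hmin (fun k => z k / r) (by rw [← Finset.sum_div, hzsum, zero_div])
    (by simp only [div_pow]; rw [← Finset.sum_div, hzsq, div_self (by positivity)])
  have hscale : ∑ k, |z k / r| ^ p = (∑ k, |z k| ^ p) / r ^ p := by
    rw [Finset.sum_div]
    refine Finset.sum_congr rfl fun k _ => ?_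
    rw [abs_div, abs_of_pos hr0, Real.div_rpow (abs_nonneg _) hr0.le]
  have hrp : r ^ p = (1 + 2 * t ^ 2) ^ (p / 2) := by
    rw [hr, Real.sqrt_eq_rpow, ← Real.rpow_mul hpos.le]
    congr 1
    ring
  rw [hscale, le_div_iff₀ (by positivity), hrp, hzp] at hle
  exact hle

/-- Strict tangent-line bound for the concave function `s ↦ s ^ q`, `0 < q < 1`. -/
theorem rpow_lt_rpow_add_tangent {b c q : ℝ} (hc : 0 < c) (hcb : c < b) (hq0 : 0 < q)
    (hq1 : q < 1) : c ^ q < b ^ q + q * b ^ (q - 1) * (c - b) := by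
  have hb : 0 < b := hc.trans hcb
  have hs : -1 ≤ c / b - 1 := by have := div_pos hc hb; linarith
  have hs0 : c / b - 1 ≠ 0 := by
    have := (div_lt_one hb).mpr hcb
    linarith
  have h := rpow_one_add_lt_one_add_mul_self hs hs0 hq0 hq1
  rw [add_sub_cancel, Real.div_rpow hc.le hb.le, div_lt_iff₀ (by positivity)] at h
  rw [Real.rpow_sub_one hb.ne']
  calc c ^ q < (1 + q * (c / b - 1)) * b ^ q := h
    _ = _ := by field_simp

/-- The graph of `s ↦ s ^ q`, `0 < q < 1`, contains no three collinear points. -/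
theorem rpow_not_three_collinear {a b c q k l : ℝ} (ha : 0 < a) (hab : a < b) (hbc : b < c)
    (hq0 : 0 < q) (hq1 : q < 1) (h1 : a ^ q = k * a + l) (h2 : b ^ q = k * b + l)
    (h3 : c ^ q = k * c + l) : False := by
  have h := (Real.strictConcaveOn_rpow hq0 hq1).slope_anti_adjacent (Set.mem_Ici.mpr ha.le)
    (Set.mem_Ici.mpr (by linarith)) hab hbc
  simp only [h1, h2, h3] at h
  rw [div_lt_div_iff₀ (by linarith) (by linarith)] at h
  linarith

/-- Structure of the negative coordinates, case `1 < p < 2`: if `x = (a, -y_1, …, -y_{d-1})`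
with `a > 0`, `y_j > 0` minimizes `∑ |x_i|^p` over the constraint set and satisfies the
Euler–Lagrange equations with `λ ≠ 0`, then after a permutation `(y_1,…,y_{d-1}) = (b,c,…,c)`
for some `b ≥ c > 0`. -/
theorem negative_coordinates_structure_p (d : ℕ) (hd : 3 ≤ d) (p : ℝ) (hp1 : 1 < p)
    (hp2 : p < 2) (x : Fin d → ℝ)
    (hsum : (∑ i, x i) = 0) (hnorm : (∑ i, (x i) ^ 2) = 1)
    (hmin : ∀ y : Fin d → ℝ, (∑ i, y i) = 0 → (∑ i, (y i) ^ 2) = 1 →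
      (∑ i, |x i| ^ p) ≤ ∑ i, |y i| ^ p)
    (ha : 0 < x (⟨0, by omega⟩ : Fin d))
    (hy : ∀ i : Fin d, i ≠ (⟨0, by omega⟩ : Fin d) → x i < 0)
    (lam mu : ℝ) (hlam : lam ≠ 0)
    (hEL : ∀ i, p * |x i| ^ (p - 2) * x i = lam + 2 * mu * x i) :
    ∃ b c : ℝ, c ≤ b ∧ 0 < c ∧ ∃ i₀ : Fin d, i₀ ≠ (⟨0, by omega⟩ : Fin d) ∧ x i₀ = -b ∧
      ∀ i : Fin d, i ≠ (⟨0, by omega⟩ : Fin d) → i ≠ i₀ → x i = -c := by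
  set o : Fin d := ⟨0, by omega⟩ with ho
  have hp0 : 0 < p := by linarith
  have henergy : p * ∑ i, |x i| ^ p = 2 * mu := by
    have hterm : ∀ i, p * |x i| ^ p = lam * x i + 2 * mu * x i ^ 2 := fun i => by
      have hxi : x i ≠ 0 := by
        by_cases hio : i = o
        · exact hio ▸ ha.ne'
        · exact (hy i hio).ne
      have habs : |x i| ^ p = |x i| ^ (p - 2) * x i ^ 2 := by
        rw [← sq_abs, ← Real.rpow_natCast, ← Real.rpow_add (abs_pos.mpr hxi)]
        norm_num
      rw [habs]
      linear_combination x i * hEL i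
    rw [Finset.mul_sum, Finset.sum_congr rfl fun i _ => hterm i, Finset.sum_add_distrib,
      ← Finset.mul_sum, ← Finset.mul_sum, hsum, hnorm]
    ring
  have hline : ∀ i, i ≠ o → (-x i) ^ (p - 1) = 2 * mu / p * (-x i) + -lam / p := fun i hi => by
    have hneg := hy i hi
    have h := hEL i
    rw [abs_of_neg hneg] at h
    have hpow : (-x i) ^ (p - 1) = (-x i) ^ (p - 2) * (-x i) := by
      rw [← Real.rpow_add_one (by linarith : -x i ≠ 0)]
      ring_nf
    rw [hpow]
    field_simp
    linarith
  have hunique : ∀ i j k, i ≠ o → j ≠ o → k ≠ o → i ≠ j → x i = x j → x i < x k → False := by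
    intro i j k hi hj hk hij hxij hlt
    have hle := sum_abs_rpow_le_of_minimizer_of_two_eq (b := -x i) hp0 (by linarith [hy i hi])
      hsum hnorm hmin hij (by ring) (by rw [hxij]; ring)
    have htan := rpow_lt_rpow_add_tangent (b := -x i) (c := -x k) (q := p - 1)
      (by linarith [hy k hk]) (by linarith) (by linarith) (by linarith)
    rw [hline i hi, hline k hk, ← henergy, mul_div_cancel_left₀ _ hp0.ne',
      show p - 1 - 1 = p - 2 by ring] at htan
    nlinarith
  have hthree : ∀ i j k, i ≠ o → j ≠ o → k ≠ o → x i < x j → x j < x k → False :=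
    fun i j k hi hj hk hij hjk =>
      rpow_not_three_collinear (by linarith [hy k hk]) (neg_lt_neg hjk) (neg_lt_neg hij)
        (by linarith) (by linarith) (hline k hk) (hline j hj) (hline i hi)
  have hne : (Finset.univ.erase o).Nonempty :=
    ⟨⟨1, by omega⟩, by simp [ho, Fin.ext_iff]⟩
  obtain ⟨m, hm, hmax⟩ := Finset.exists_max_image _ x hne
  have hmo : m ≠ o := Finset.ne_of_mem_erase hm
  replace hmax : ∀ i, i ≠ o → x i ≤ x m := fun i hi =>
    hmax i (Finset.mem_erase.mpr ⟨hi, Finset.mem_univ i⟩)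
  by_cases hconst : ∀ i, i ≠ o → x i = x m
  · exact ⟨-x m, -x m, le_rfl, by linarith [hy m hmo], m, hmo, by ring,
      fun i hi _ => by rw [hconst i hi]; ring⟩
  · push Not at hconst
    obtain ⟨i₀, hi₀, hne₀⟩ := hconst
    have hlt₀ : x i₀ < x m := lt_of_le_of_ne (hmax i₀ hi₀) hne₀
    refine ⟨-x i₀, -x m, by linarith, by linarith [hy m hmo], i₀, hi₀, by ring,
      fun i hi hii₀ => ?_⟩
    rw [neg_neg]
    by_contra hnem
    have hlt : x i < x m := lt_of_le_of_ne (hmax i hi) hnem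
    rcases lt_trichotomy (x i) (x i₀) with h | h | h
    · exact hthree i i₀ m hi hi₀ hmo h hlt₀
    · exact hunique i i₀ m hi hi₀ hmo hii₀ h hlt
    · exact hthree i₀ i m hi₀ hi hmo h hlt
end

section
/- Let ℓ ≥ 1 be an integer and 1 < p < 2. Define Ψ(w) = ((1+ℓw)^p + 1 + ℓ w^p) / (2 + 2ℓw + ℓ(ℓ+1)w²)^{p/2} for w ∈ [0,1]. Then Ψ has at most one critical point in the open interval (0,1), any such critical point is a strict local maximum, and Ψ(w) > min{Ψ(0), Ψ(1)} for all 0 < w < 1. -/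
open Topology

/-- The one-variable function `Ψ(w) = ((1+ℓw)^r + 1 + ℓ w^r) / (2 + 2ℓw + ℓ(ℓ+1)w²)^(r/2)`. -/
noncomputable def Psi (ℓ : ℕ) (r : ℝ) (w : ℝ) : ℝ :=
  ((1 + (ℓ : ℝ) * w) ^ r + 1 + (ℓ : ℝ) * w ^ r) /
    (2 + 2 * (ℓ : ℝ) * w + (ℓ : ℝ) * ((ℓ : ℝ) + 1) * w ^ 2) ^ (r / 2)

/-- For `D = 2 + 2Lw + L(L+1)w²`, the derivative of `Psi` with exponent `s + 1` and `ℓ = L` is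
this function multiplied by the positive factor `(s + 1) L / D^((s+1)/2 + 1)`. -/
noncomputable def psiSlope (L s w : ℝ) : ℝ :=
  (1 - w) * (1 + L * w) ^ s + (2 + L * w) * w ^ s - 1 - (L + 1) * w

/-- The derivative of `psiSlope`. -/
noncomputable def psiSlopeDeriv (L s w : ℝ) : ℝ :=
  -(1 + L * w) ^ s + (1 - w) * (L * s * (1 + L * w) ^ (s - 1)) + L * w ^ s
    + (2 + L * w) * (s * w ^ (s - 1)) - (L + 1)

/-- The second derivative of `psiSlope`, divided by `s (1 + L w)^(s-1)`, as a function of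
`t = (1 + L w) / w` and `σ = 1 - s`. -/
noncomputable def psiCurvature (L σ t : ℝ) : ℝ :=
  t ^ σ * (L * (2 + σ) - 2 * σ * t) + (-2 * L - σ * L ^ 2) + σ * L ^ 2 * (L + 1) / t

lemma hasDerivAt_one_add_mul_rpow {L w : ℝ} (r : ℝ) (h : 0 < 1 + L * w) :
    HasDerivAt (fun x : ℝ => (1 + L * x) ^ r) (L * r * (1 + L * w) ^ (r - 1)) w := by
  have h1 : HasDerivAt (fun x : ℝ => 1 + L * x) L w := by
    simpa using ((hasDerivAt_id w).const_mul L).const_add 1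
  exact h1.rpow_const (Or.inl h.ne')

lemma hasDerivAt_psiSlope {L w : ℝ} (hL : 0 < L) (s : ℝ) (hw : 0 < w) :
    HasDerivAt (psiSlope L s) (psiSlopeDeriv L s w) w := by
  have ha : 0 < 1 + L * w := by positivity
  have h1 := hasDerivAt_one_add_mul_rpow s ha
  have h2 := Real.hasDerivAt_rpow_const (p := s) (Or.inl hw.ne')
  have h3 := hasDerivAt_id' w
  have h := ((((h3.const_sub 1).mul h1).add (((h3.const_mul L).const_add 2).mul h2)).sub_const
    1).sub (h3.const_mul (L + 1))
  refine HasDerivAt.congr_deriv h ?_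
  unfold psiSlopeDeriv
  ring

lemma hasDerivAt_psiSlopeDeriv {L w : ℝ} (hL : 0 < L) (s : ℝ) (hw : 0 < w) :
    HasDerivAt (psiSlopeDeriv L s)
      (s * (1 + L * w) ^ (s - 1) * psiCurvature L (1 - s) ((1 + L * w) / w)) w := by
  have ha : 0 < 1 + L * w := by positivity
  have h1 := hasDerivAt_one_add_mul_rpow s ha
  have h1' := hasDerivAt_one_add_mul_rpow (s - 1) ha
  have h2 := Real.hasDerivAt_rpow_const (p := s) (Or.inl hw.ne')
  have h2' := Real.hasDerivAt_rpow_const (p := s - 1) (Or.inl hw.ne')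
  have h3 := hasDerivAt_id' w
  have h := ((((h1.neg.add ((h3.const_sub 1).mul (h1'.const_mul (L * s)))).add
    (h2.const_mul L)).add (((h3.const_mul L).const_add 2).mul (h2'.const_mul s)))).sub_const (L + 1)
  refine HasDerivAt.congr_deriv h ?_
  have e1 : (1 + L * w) ^ (s - 1 - 1) = (1 + L * w) ^ (s - 1) / (1 + L * w) :=
    Real.rpow_sub_one ha.ne' _
  have e2 : w ^ (s - 1 - 1) = w ^ (s - 1) / w := Real.rpow_sub_one hw.ne' _
  have e3 : w ^ (s - 1) = (1 + L * w) ^ (s - 1) * ((1 + L * w) / w) ^ (1 - s) := by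
    rw [Real.div_rpow ha.le hw.le, show (1 - s) = -(s - 1) by ring, Real.rpow_neg ha.le,
      Real.rpow_neg hw.le]
    have := (Real.rpow_pos_of_pos ha (s - 1)).ne'
    field_simp
  rw [e2, e1, e3]
  unfold psiCurvature
  generalize ((1 + L * w) / w) ^ (1 - s) = T
  generalize (1 + L * w) ^ (s - 1) = A
  field_simp
  ring

lemma psiCurvature_strictAntiOn {L σ : ℝ} (hL : 0 < L) (hσ : 0 < σ) :
    StrictAntiOn (psiCurvature L σ) (Set.Ioi (L + 1)) := by
  have key : StrictAntiOn (fun t : ℝ => t ^ σ * (L * (2 + σ) - 2 * σ * t)) (Set.Ioi (L + 1)) := by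
    have hd : ∀ t ∈ Set.Ioi (L + 1), HasDerivAt (fun t : ℝ => t ^ σ * (L * (2 + σ) - 2 * σ * t))
        (σ * t ^ (σ - 1) * (L * (2 + σ) - 2 * (σ + 1) * t)) t := by
      intro t ht
      have ht0 : 0 < t := by have := Set.mem_Ioi.1 ht; linarith
      have h := (Real.hasDerivAt_rpow_const (p := σ) (Or.inl ht0.ne')).mul
        (((hasDerivAt_id' t).const_mul (2 * σ)).const_sub (L * (2 + σ)))
      refine HasDerivAt.congr_deriv h ?_
      have e : t ^ σ = t ^ (σ - 1) * t := by
        rw [Real.rpow_sub_one ht0.ne', div_mul_cancel₀ _ ht0.ne']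
      rw [e]
      ring
    refine strictAntiOn_of_deriv_neg (convex_Ioi _)
      (fun t ht => (hd t ht).continuousAt.continuousWithinAt) ?_
    intro t ht
    rw [interior_Ioi] at ht
    rw [(hd t ht).deriv]
    have ht' : L + 1 < t := ht
    have ht0 : 0 < t := by linarith
    have : 0 < σ * t ^ (σ - 1) := mul_pos hσ (Real.rpow_pos_of_pos ht0 _)
    refine mul_neg_of_pos_of_neg this ?_
    nlinarith [mul_pos hσ hL, mul_pos hσ (sub_pos.2 ht')]
  intro x hx y hy hxy
  have h := key hx hy hxy
  have hx0 : 0 < x := by have := Set.mem_Ioi.1 hx; linarith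
  have h2 : σ * L ^ 2 * (L + 1) / y < σ * L ^ 2 * (L + 1) / x := by gcongr
  simp only [psiCurvature] at h ⊢
  linarith

/-- The derivative of `psiSlope` has at most two zeros in `(0, 1)`. -/
lemma psiSlopeDeriv_not_three_zeros {L s x y z : ℝ} (hL : 0 < L) (hs0 : 0 < s) (hs1 : s < 1)
    (hx : 0 < x) (hxy : x < y) (hyz : y < z) (hz : z < 1) (ex : psiSlopeDeriv L s x = 0)
    (ey : psiSlopeDeriv L s y = 0) (ez : psiSlopeDeriv L s z = 0) : False := by
  have rolle : ∀ a b, 0 < a → a < b → psiSlopeDeriv L s a = 0 → psiSlopeDeriv L s b = 0 →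
      ∃ c ∈ Set.Ioo a b, psiCurvature L (1 - s) ((1 + L * c) / c) = 0 := by
    intro a b ha hab ea eb
    obtain ⟨c, hc, h⟩ := exists_hasDerivAt_eq_zero hab
      (fun u hu => (hasDerivAt_psiSlopeDeriv hL s
        (lt_of_lt_of_le ha hu.1)).continuousAt.continuousWithinAt) (ea.trans eb.symm)
      (fun u hu => hasDerivAt_psiSlopeDeriv hL s (ha.trans hu.1))
    refine ⟨c, hc, ?_⟩
    have hc0 : 0 < c := ha.trans hc.1
    have : 0 < s * (1 + L * c) ^ (s - 1) := by positivity
    exact (mul_eq_zero.1 h).resolve_left this.ne'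
  obtain ⟨c, hc, ec⟩ := rolle x y hx hxy ex ey
  obtain ⟨d, hd, ed⟩ := rolle y z (hx.trans hxy) hyz ey ez
  have hc0 : 0 < c := hx.trans hc.1
  have hcd : c < d := hc.2.trans hd.1
  have hd0 : 0 < d := hc0.trans hcd
  have hd1 : d < 1 := hd.2.trans hz
  have form : ∀ u : ℝ, 0 < u → (1 + L * u) / u = L + 1 / u := by
    intro u hu
    field_simp
    ring
  have h1 : 1 < 1 / d := by rwa [lt_div_iff₀ hd0, one_mul]
  have h2 : 1 / d < 1 / c := one_div_lt_one_div_of_lt hc0 hcd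
  rw [form c hc0] at ec
  rw [form d hd0] at ed
  have := psiCurvature_strictAntiOn hL (sub_pos.2 hs1) (a := L + 1 / d) (b := L + 1 / c)
    (Set.mem_Ioi.2 (by linarith)) (Set.mem_Ioi.2 (by linarith)) (by linarith)
  rw [ec, ed] at this
  exact lt_irrefl _ this

lemma psiSlope_zero (L : ℝ) {s : ℝ} (hs : 0 < s) : psiSlope L s 0 = 0 := by
  simp [psiSlope, Real.zero_rpow hs.ne']

lemma psiSlope_one (L s : ℝ) : psiSlope L s 1 = 0 := by
  simp only [psiSlope, Real.one_rpow]
  ring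

lemma continuousOn_psiSlope {L s : ℝ} (hL : 0 < L) (hs : 0 < s) :
    ContinuousOn (psiSlope L s) (Set.Ici 0) := by
  intro w hw
  have hw0 : 0 ≤ w := hw
  have ha : 1 + L * w ≠ 0 := by positivity
  refine ContinuousAt.continuousWithinAt ?_
  have h1 : ContinuousAt (fun x : ℝ => (1 + L * x) ^ s) w :=
    ContinuousAt.rpow_const (by fun_prop) (Or.inl ha)
  have h2 : ContinuousAt (fun x : ℝ => x ^ s) w :=
    ContinuousAt.rpow_const (by fun_prop) (Or.inr hs.le)
  have h3 : ContinuousAt (fun x : ℝ => 1 - x) w := by fun_prop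
  have h4 : ContinuousAt (fun x : ℝ => 2 + L * x) w := by fun_prop
  have h5 : ContinuousAt (fun x : ℝ => (L + 1) * x) w := by fun_prop
  exact (((h3.mul h1).add (h4.mul h2)).sub continuousAt_const).sub h5

lemma exists_psiSlope_pos {L s b : ℝ} (hL : 0 < L) (hs0 : 0 < s) (hs1 : s < 1) (hb0 : 0 < b)
    (hb1 : b ≤ 1) : ∃ w ∈ Set.Ioo 0 b, 0 < psiSlope L s w := by
  have hc : ContinuousAt (fun w : ℝ => (L + 2) * w ^ (1 - s)) 0 :=
    (ContinuousAt.rpow_const continuousAt_id (Or.inr (by linarith))).const_mul _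
  have hlt : ∀ᶠ w in 𝓝[>] (0 : ℝ), (L + 2) * w ^ (1 - s) < 2 := by
    refine nhdsWithin_le_nhds (hc.eventually_lt continuousAt_const ?_)
    simp [Real.zero_rpow (sub_pos.2 hs1).ne']
  obtain ⟨w, h, hw⟩ := (hlt.and (Ioo_mem_nhdsGT hb0)).exists
  refine ⟨w, hw, ?_⟩
  have hw0 : 0 < w := hw.1
  have hw1 : w < 1 := hw.2.trans_le hb1
  have h1 : 1 ≤ (1 + L * w) ^ s := Real.one_le_rpow (by nlinarith) hs0.le
  have hp : 0 < w ^ s := Real.rpow_pos_of_pos hw0 s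
  have e : w ^ (1 - s) * w ^ s = w := by
    rw [← Real.rpow_add hw0]; simp
  have h2 : (L + 2) * w < 2 * w ^ s := by
    nlinarith [mul_lt_mul_of_pos_right h hp]
  have h3 : 0 < L * w * w ^ s := by positivity
  unfold psiSlope
  nlinarith [mul_le_mul_of_nonneg_left h1 (sub_pos.2 hw1).le]

lemma exists_psiSlopeDeriv_eq_zero {L s a b : ℝ} (hL : 0 < L) (hs0 : 0 < s) (ha : 0 ≤ a)
    (hab : a < b) (ea : psiSlope L s a = 0) (eb : psiSlope L s b = 0) :
    ∃ c ∈ Set.Ioo a b, psiSlopeDeriv L s c = 0 :=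
  exists_hasDerivAt_eq_zero hab
    ((continuousOn_psiSlope hL hs0).mono fun _ hu => ha.trans hu.1) (ea.trans eb.symm)
    (fun _ hu => hasDerivAt_psiSlope hL s (ha.trans_lt hu.1))

lemma psiSlope_zero_unique {L s x y : ℝ} (hL : 0 < L) (hs0 : 0 < s) (hs1 : s < 1)
    (hx : x ∈ Set.Ioo (0 : ℝ) 1) (hy : y ∈ Set.Ioo (0 : ℝ) 1) (ex : psiSlope L s x = 0)
    (ey : psiSlope L s y = 0) : x = y := by
  wlog hxy : x < y generalizing x y
  · rcases (not_lt.1 hxy).eq_or_lt with h | h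
    · exact h.symm
    · exact (this hy hx ey ex h).symm
  exfalso
  obtain ⟨a, ha, ea⟩ := exists_psiSlopeDeriv_eq_zero hL hs0 le_rfl hx.1 (psiSlope_zero L hs0) ex
  obtain ⟨b, hb, eb⟩ := exists_psiSlopeDeriv_eq_zero hL hs0 hx.1.le hxy ex ey
  obtain ⟨c, hc, ec⟩ := exists_psiSlopeDeriv_eq_zero hL hs0 hy.1.le hy.2 ey (psiSlope_one L s)
  exact psiSlopeDeriv_not_three_zeros hL hs0 hs1 ha.1 (ha.2.trans hb.1) (hb.2.trans hc.1) hc.2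
    ea eb ec

/-- A continuous function without zeros on an interval that is positive somewhere is positive. -/
lemma pos_of_ne_zero_of_exists_pos {f : ℝ → ℝ} {a b : ℝ} (hf : ContinuousOn f (Set.Ioo a b))
    (hne : ∀ x ∈ Set.Ioo a b, f x ≠ 0) (hpos : ∃ x ∈ Set.Ioo a b, 0 < f x) :
    ∀ x ∈ Set.Ioo a b, 0 < f x := by
  intro x hx
  obtain ⟨y, hy, hfy⟩ := hpos
  by_contra! h
  obtain ⟨z, hz, e⟩ := isPreconnected_Ioo.intermediate_value hx hy hf ⟨h, hfy.le⟩
  exact hne z hz e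

lemma psiSlope_pos_of_ne_zero {L s b : ℝ} (hL : 0 < L) (hs0 : 0 < s) (hs1 : s < 1) (hb0 : 0 < b)
    (hb1 : b ≤ 1) (hne : ∀ x ∈ Set.Ioo 0 b, psiSlope L s x ≠ 0) :
    ∀ x ∈ Set.Ioo 0 b, 0 < psiSlope L s x :=
  pos_of_ne_zero_of_exists_pos ((continuousOn_psiSlope hL hs0).mono fun _ hu => hu.1.le) hne
    (exists_psiSlope_pos hL hs0 hs1 hb0 hb1)

lemma psiSlope_pos_of_lt {L s z : ℝ} (hL : 0 < L) (hs0 : 0 < s) (hs1 : s < 1)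
    (hz : z ∈ Set.Ioo (0 : ℝ) 1) (ez : psiSlope L s z = 0) :
    ∀ x ∈ Set.Ioo 0 z, 0 < psiSlope L s x :=
  psiSlope_pos_of_ne_zero hL hs0 hs1 hz.1 hz.2.le fun _ hx ex =>
    hx.2.ne (psiSlope_zero_unique hL hs0 hs1 ⟨hx.1, hx.2.trans hz.2⟩ hz ex ez)

lemma psiSlope_neg_of_gt {L s z : ℝ} (hL : 0 < L) (hs0 : 0 < s) (hs1 : s < 1)
    (hz : z ∈ Set.Ioo (0 : ℝ) 1) (ez : psiSlope L s z = 0) :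
    ∀ x ∈ Set.Ioo z 1, psiSlope L s x < 0 := by
  have hne : ∀ x ∈ Set.Ioo z 1, psiSlope L s x ≠ 0 := fun x hx ex =>
    hx.1.ne' (psiSlope_zero_unique hL hs0 hs1 ⟨hz.1.trans hx.1, hx.2⟩ hz ex ez)
  intro x hx
  by_contra! h
  have hright := pos_of_ne_zero_of_exists_pos
    ((continuousOn_psiSlope hL hs0).mono fun u (hu : u ∈ Set.Ioo z 1) => (hz.1.trans hu.1).le)
    hne ⟨x, hx, h.lt_of_ne' (hne x hx)⟩
  have hleft := psiSlope_pos_of_lt hL hs0 hs1 hz ez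
  have hmin : IsLocalMin (psiSlope L s) z := by
    filter_upwards [Ioo_mem_nhds hz.1 hz.2] with u hu
    rw [ez]
    rcases lt_trichotomy u z with h | h | h
    · exact (hleft u ⟨hu.1, h⟩).le
    · rw [h, ez]
    · exact (hright u ⟨h, hu.2⟩).le
  have eb := hmin.hasDerivAt_eq_zero (hasDerivAt_psiSlope hL s hz.1)
  obtain ⟨a, ha, ea⟩ := exists_psiSlopeDeriv_eq_zero hL hs0 le_rfl hz.1 (psiSlope_zero L hs0) ez
  obtain ⟨c, hc, ec⟩ := exists_psiSlopeDeriv_eq_zero hL hs0 hz.1.le hz.2 ez (psiSlope_one L s)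
  exact psiSlopeDeriv_not_three_zeros hL hs0 hs1 ha.1 ha.2 hc.1 hc.2 ea eb ec

lemma hasDerivAt_Psi (ℓ : ℕ) (p : ℝ) {w : ℝ} (hw : 0 < w) :
    HasDerivAt (Psi ℓ p)
      (p * ℓ / (2 + 2 * (ℓ : ℝ) * w + (ℓ : ℝ) * ((ℓ : ℝ) + 1) * w ^ 2) ^ (p / 2 + 1) *
        psiSlope ℓ (p - 1) w) w := by
  have hL : (0 : ℝ) ≤ ℓ := Nat.cast_nonneg ℓ
  generalize hLdef : (ℓ : ℝ) = L at hL
  have ha : 0 < 1 + L * w := by positivity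
  have hD : 0 < 2 + 2 * L * w + L * (L + 1) * w ^ 2 := by positivity
  have h1 := hasDerivAt_one_add_mul_rpow p ha
  have h2 := Real.hasDerivAt_rpow_const (p := p) (Or.inl hw.ne')
  have h3 := hasDerivAt_id' w
  have hpoly : HasDerivAt (fun x : ℝ => 2 + 2 * L * x + L * (L + 1) * x ^ 2)
      (2 * L + L * (L + 1) * (2 * w)) w :=
    HasDerivAt.congr_deriv (((h3.const_mul (2 * L)).const_add 2).add
      ((h3.pow 2).const_mul (L * (L + 1)))) (by simp)
  have h4 := hpoly.rpow_const (p := p / 2) (Or.inl hD.ne')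
  have h := ((h1.add_const 1).add (h2.const_mul L)).div h4 (Real.rpow_pos_of_pos hD _).ne'
  unfold Psi
  rw [hLdef]
  refine HasDerivAt.congr_deriv h ?_
  have e1 : (1 + L * w) ^ p = (1 + L * w) ^ (p - 1) * (1 + L * w) := by
    rw [Real.rpow_sub_one ha.ne', div_mul_cancel₀ _ ha.ne']
  have e2 : w ^ p = w ^ (p - 1) * w := by
    rw [Real.rpow_sub_one hw.ne', div_mul_cancel₀ _ hw.ne']
  simp only [Pi.add_apply, psiSlope]
  rw [Real.rpow_add_one hD.ne', Real.rpow_sub_one hD.ne', e1, e2]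
  have hQ := Real.rpow_pos_of_pos hD (p / 2)
  generalize (2 + 2 * L * w + L * (L + 1) * w ^ 2) ^ (p / 2) = Q at hQ ⊢
  generalize (1 + L * w) ^ (p - 1) = A
  generalize w ^ (p - 1) = B
  field_simp
  ring

lemma continuousOn_Psi (ℓ : ℕ) {p : ℝ} (hp : 0 < p) : ContinuousOn (Psi ℓ p) (Set.Ici 0) := by
  intro w hw
  have hw0 : 0 ≤ w := hw
  have ha : 1 + (ℓ : ℝ) * w ≠ 0 := by positivity
  have hD : 0 < 2 + 2 * (ℓ : ℝ) * w + (ℓ : ℝ) * ((ℓ : ℝ) + 1) * w ^ 2 := by positivity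
  refine ContinuousAt.continuousWithinAt ?_
  have h1 : ContinuousAt (fun x : ℝ => (1 + (ℓ : ℝ) * x) ^ p) w :=
    ContinuousAt.rpow_const (by fun_prop) (Or.inl ha)
  have h2 : ContinuousAt (fun x : ℝ => x ^ p) w :=
    ContinuousAt.rpow_const (by fun_prop) (Or.inr hp.le)
  have h3 : ContinuousAt (fun x : ℝ =>
      (2 + 2 * (ℓ : ℝ) * x + (ℓ : ℝ) * ((ℓ : ℝ) + 1) * x ^ 2) ^ (p / 2)) w :=
    ContinuousAt.rpow_const (by fun_prop) (Or.inl hD.ne')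
  exact ((h1.add_const 1).add (h2.const_mul _)).div h3 (Real.rpow_pos_of_pos hD _).ne'

lemma psi_deriv_factor_pos {ℓ : ℕ} (hℓ : 1 ≤ ℓ) {p w : ℝ} (hp : 0 < p) (hw : 0 < w) :
    0 < p * ℓ / (2 + 2 * (ℓ : ℝ) * w + (ℓ : ℝ) * ((ℓ : ℝ) + 1) * w ^ 2) ^ (p / 2 + 1) := by
  have hL : (0 : ℝ) < ℓ := by exact_mod_cast hℓ
  positivity

lemma psi_strictMonoOn {ℓ : ℕ} (hℓ : 1 ≤ ℓ) {p a b : ℝ} (hp : 0 < p) (ha : 0 ≤ a)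
    (h : ∀ x ∈ Set.Ioo a b, 0 < psiSlope ℓ (p - 1) x) : StrictMonoOn (Psi ℓ p) (Set.Icc a b) := by
  refine strictMonoOn_of_deriv_pos (convex_Icc a b)
    ((continuousOn_Psi ℓ hp).mono fun _ hu => ha.trans hu.1) fun x hx => ?_
  rw [interior_Icc] at hx
  have hx0 := ha.trans_lt hx.1
  rw [(hasDerivAt_Psi ℓ p hx0).deriv]
  exact mul_pos (psi_deriv_factor_pos hℓ hp hx0) (h x hx)

lemma psi_strictAntiOn {ℓ : ℕ} (hℓ : 1 ≤ ℓ) {p a b : ℝ} (hp : 0 < p) (ha : 0 ≤ a)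
    (h : ∀ x ∈ Set.Ioo a b, psiSlope ℓ (p - 1) x < 0) : StrictAntiOn (Psi ℓ p) (Set.Icc a b) := by
  refine strictAntiOn_of_deriv_neg (convex_Icc a b)
    ((continuousOn_Psi ℓ hp).mono fun _ hu => ha.trans hu.1) fun x hx => ?_
  rw [interior_Icc] at hx
  have hx0 := ha.trans_lt hx.1
  rw [(hasDerivAt_Psi ℓ p hx0).deriv]
  exact mul_neg_of_pos_of_neg (psi_deriv_factor_pos hℓ hp hx0) (h x hx)

/-- For `ℓ ≥ 1` and `1 < p < 2`, the function `Ψ` has at most one critical point in `(0,1)`,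
any such critical point is a strict local maximum, and `Ψ(w) > min{Ψ(0), Ψ(1)}`
for all `0 < w < 1`. -/
theorem psi_one_lt_p_lt_two (ℓ : ℕ) (hℓ : 1 ≤ ℓ) (p : ℝ) (hp1 : 1 < p) (hp2 : p < 2) :
    (∀ w₁ ∈ Set.Ioo (0 : ℝ) 1, ∀ w₂ ∈ Set.Ioo (0 : ℝ) 1,
      deriv (Psi ℓ p) w₁ = 0 → deriv (Psi ℓ p) w₂ = 0 → w₁ = w₂) ∧
    (∀ w ∈ Set.Ioo (0 : ℝ) 1, deriv (Psi ℓ p) w = 0 →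
      ∀ᶠ y in 𝓝[≠] w, Psi ℓ p y < Psi ℓ p w) ∧
    (∀ w ∈ Set.Ioo (0 : ℝ) 1, min (Psi ℓ p 0) (Psi ℓ p 1) < Psi ℓ p w) := by
  have hL : (0 : ℝ) < ℓ := by exact_mod_cast hℓ
  have hp0 : 0 < p := by linarith
  have hs0 : 0 < p - 1 := by linarith
  have hs1 : p - 1 < 1 := by linarith
  have crit : ∀ w ∈ Set.Ioo (0 : ℝ) 1, deriv (Psi ℓ p) w = 0 → psiSlope ℓ (p - 1) w = 0 := by
    intro w hw h
    rw [(hasDerivAt_Psi ℓ p hw.1).deriv] at h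
    exact (mul_eq_zero.1 h).resolve_left (psi_deriv_factor_pos hℓ hp0 hw.1).ne'
  have mono : ∀ z ∈ Set.Ioo (0 : ℝ) 1, psiSlope ℓ (p - 1) z = 0 →
      StrictMonoOn (Psi ℓ p) (Set.Icc 0 z) := fun z hz ez =>
    psi_strictMonoOn hℓ hp0 le_rfl (psiSlope_pos_of_lt hL hs0 hs1 hz ez)
  have anti : ∀ z ∈ Set.Ioo (0 : ℝ) 1, psiSlope ℓ (p - 1) z = 0 →
      StrictAntiOn (Psi ℓ p) (Set.Icc z 1) := fun z hz ez =>
    psi_strictAntiOn hℓ hp0 hz.1.le (psiSlope_neg_of_gt hL hs0 hs1 hz ez)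
  refine ⟨fun w₁ h₁ w₂ h₂ e₁ e₂ =>
    psiSlope_zero_unique hL hs0 hs1 h₁ h₂ (crit _ h₁ e₁) (crit _ h₂ e₂), ?_, ?_⟩
  · intro w hw e
    have ew := crit w hw e
    filter_upwards [nhdsWithin_le_nhds (Ioo_mem_nhds hw.1 hw.2), self_mem_nhdsWithin] with y hy hne
    rcases lt_or_gt_of_ne (show y ≠ w from hne) with h | h
    · exact mono w hw ew ⟨hy.1.le, h.le⟩ ⟨hw.1.le, le_rfl⟩ h
    · exact anti w hw ew ⟨le_rfl, hw.2.le⟩ ⟨h.le, hy.2.le⟩ h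
  · intro w hw
    by_cases hz : ∃ z ∈ Set.Ioo (0 : ℝ) 1, psiSlope ℓ (p - 1) z = 0
    · obtain ⟨z, hz, ez⟩ := hz
      rcases le_total w z with h | h
      · exact min_lt_of_left_lt (mono z hz ez ⟨le_rfl, hz.1.le⟩ ⟨hw.1.le, h⟩ hw.1)
      · exact min_lt_of_right_lt (anti z hz ez ⟨h, hw.2.le⟩ ⟨hz.2.le, le_rfl⟩ hw.2)
    · push Not at hz
      exact min_lt_of_left_lt (psi_strictMonoOn hℓ hp0 le_rfl
        (psiSlope_pos_of_ne_zero hL hs0 hs1 one_pos le_rfl hz)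
        ⟨le_rfl, zero_le_one⟩ ⟨hw.1.le, hw.2.le⟩ hw.1)
end

section
/- Let d ≥ 3, q > 2, and let x ∈ ℝ^d satisfy ∑_{i=1}^d x_i = 0 and ∑_{i=1}^d x_i² = 1. Suppose there exist λ, μ ∈ ℝ such that q|x_i|^{q−2} x_i = λ + 2μ x_i for all 1 ≤ i ≤ d. Then μ > 0; moreover, if λ = 0 then F(x) := ∑_{i=1}^d |x_i|^q ≤ 2^{1−q/2}, with equality exactly when x equals, up to a permutation of coordinates and a global sign, the vector (1/√2)(1, −1, 0, …, 0). -/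
/-- A permutation can send any two distinct points to any two distinct points. -/
theorem exists_perm_apply_eq_and_apply_eq {α : Type*} [DecidableEq α] {a b c e : α}
    (hab : a ≠ b) (hce : c ≠ e) : ∃ σ : Equiv.Perm α, σ a = c ∧ σ b = e := by
  refine ⟨(Equiv.swap a c).trans (Equiv.swap (Equiv.swap a c b) e), ?_, by simp⟩
  have h : c ≠ Equiv.swap a c b := by
    intro h
    apply hab
    apply (Equiv.swap a c).injective
    rw [← h, Equiv.swap_apply_left]
  simp [Equiv.swap_apply_of_ne_of_ne h hce]

theorem one_div_sqrt_two_rpow (q : ℝ) :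
    (1 / Real.sqrt 2) ^ (q - 2) = (2 : ℝ) ^ (1 - q / 2) := by
  rw [Real.sqrt_eq_rpow, one_div, ← Real.rpow_neg (by norm_num), ← Real.rpow_mul (by norm_num)]
  congr 1
  ring


/-- Lemma on Lagrange multipliers, case `q > 2`: if `x` satisfies the constraints
`∑ x_i = 0`, `∑ x_i² = 1` and the Euler–Lagrange equations
`q |x_i|^(q-2) x_i = λ + 2 μ x_i`, then `μ > 0`; moreover, if `λ = 0` then
`∑ |x_i|^q ≤ 2^(1-q/2)`, with equality exactly for `(1/√2)(1,-1,0,…,0)`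
up to permutation and a global sign. -/
theorem lagrange_lambda_zero_q (d : ℕ) (hd : 3 ≤ d) (q : ℝ) (hq : 2 < q)
    (x : Fin d → ℝ) (hsum : (∑ i, x i) = 0) (hnorm : (∑ i, (x i) ^ 2) = 1)
    (lam mu : ℝ) (hEL : ∀ i, q * |x i| ^ (q - 2) * x i = lam + 2 * mu * x i) :
    0 < mu ∧ (lam = 0 →
      ((∑ i, |x i| ^ q) ≤ (2 : ℝ) ^ (1 - q / 2) ∧
        ((∑ i, |x i| ^ q) = (2 : ℝ) ^ (1 - q / 2) ↔
          ∃ σ : Equiv.Perm (Fin d), ∃ ε : ℝ, (ε = 1 ∨ ε = -1) ∧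
            ∀ i, x i = ε * (if σ i = (⟨0, by omega⟩ : Fin d) then 1 / Real.sqrt 2
              else if σ i = (⟨1, by omega⟩ : Fin d) then -1 / Real.sqrt 2 else 0)))) := by
  have hq0 : 0 < q := by linarith
  have hterm : ∀ i, q * |x i| ^ q = lam * x i + 2 * mu * x i ^ 2 := by
    intro i
    rcases eq_or_ne (x i) 0 with h | h
    · simp [h, Real.zero_rpow hq0.ne']
    · have hp : |x i| ^ q = |x i| ^ (q - 2) * x i ^ 2 := by
        rw [← sq_abs, ← Real.rpow_natCast, ← Real.rpow_add (abs_pos.mpr h)]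
        norm_num
      rw [hp]
      linear_combination x i * hEL i
  have hF : q * ∑ i, |x i| ^ q = 2 * mu := by
    rw [Finset.mul_sum, Finset.sum_congr rfl fun i _ => hterm i, Finset.sum_add_distrib,
      ← Finset.mul_sum, ← Finset.mul_sum, hsum, hnorm]
    ring
  obtain ⟨j, hj⟩ : ∃ j, x j ≠ 0 := by
    by_contra! h
    simp [h] at hnorm
  have hFpos : 0 < ∑ i, |x i| ^ q :=
    Finset.sum_pos' (fun i _ => by positivity)
      ⟨j, Finset.mem_univ j, Real.rpow_pos_of_pos (abs_pos.mpr hj) q⟩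
  refine ⟨by nlinarith [mul_pos hq0 hFpos], ?_⟩
  rintro rfl
  have hval : ∀ i, x i ≠ 0 → ∑ k, |x k| ^ q = |x i| ^ (q - 2) := by
    intro i hi
    apply mul_left_cancel₀ hq0.ne'
    rw [hF]
    apply mul_right_cancel₀ hi
    rw [hEL i]
    ring
  obtain ⟨a, -, ha⟩ := Finset.exists_pos_of_sum_zero_of_exists_nonzero x hsum
    ⟨j, Finset.mem_univ j, hj⟩
  obtain ⟨b, -, hb⟩ := Finset.exists_pos_of_sum_zero_of_exists_nonzero (fun i => -x i)
    (by simp [hsum]) ⟨j, Finset.mem_univ j, neg_ne_zero.mpr hj⟩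
  rw [neg_pos] at hb
  have hab : a ≠ b := by
    rintro rfl
    exact lt_asymm ha hb
  have hba : x b = -x a := by
    have h := (hval b hb.ne).symm.trans (hval a ha.ne')
    rw [Real.rpow_left_inj (abs_nonneg _) (abs_nonneg _) (by linarith), abs_of_neg hb,
      abs_of_pos ha] at h
    linarith
  have hpair : x a ^ 2 + x b ^ 2 ≤ 1 := by
    rw [← hnorm, ← Finset.sum_pair hab (f := fun i => x i ^ 2)]
    exact Finset.sum_le_sum_of_subset_of_nonneg (Finset.subset_univ _)
      fun i _ _ => sq_nonneg (x i)
  have hs : (1 / Real.sqrt 2) ^ 2 = (1 / 2 : ℝ) := by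
    rw [div_pow, Real.sq_sqrt (by norm_num), one_pow]
  have hs0 : 0 < 1 / Real.sqrt 2 := by positivity
  rw [← one_div_sqrt_two_rpow]
  refine ⟨?_, ?_, ?_⟩
  · rw [hval a ha.ne', abs_of_pos ha]
    refine Real.rpow_le_rpow ha.le ?_ (by linarith)
    apply le_of_sq_le_sq ?_ hs0.le
    rw [hs]
    rw [hba] at hpair
    linarith
  · intro h
    rw [hval a ha.ne', abs_of_pos ha, Real.rpow_left_inj ha.le hs0.le (by linarith)] at h
    have hzero : ∀ i, i ≠ a → i ≠ b → x i = 0 := by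
      intro i hia hib
      have hle : ∑ k ∈ {i, a, b}, x k ^ 2 ≤ ∑ k, x k ^ 2 :=
        Finset.sum_le_sum_of_subset_of_nonneg (Finset.subset_univ _)
          fun k _ _ => sq_nonneg (x k)
      rw [Finset.sum_insert (by simp [hia, hib]), Finset.sum_pair hab, hnorm, hba, neg_sq, h,
        hs] at hle
      exact pow_eq_zero_iff two_ne_zero |>.mp (le_antisymm (by linarith) (sq_nonneg _))
    obtain ⟨σ, hσa, hσb⟩ := exists_perm_apply_eq_and_apply_eq hab
      (c := (⟨0, by omega⟩ : Fin d)) (e := ⟨1, by omega⟩) (by simp)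
    refine ⟨σ, 1, Or.inl rfl, fun i => ?_⟩
    rw [one_mul, ← hσa, ← hσb]
    simp only [σ.injective.eq_iff]
    split_ifs with hia hib
    · rw [hia, h]
    · rw [hib, hba, h, neg_div]
    · exact hzero i hia hib
  · rintro ⟨σ, ε, hε, hx⟩
    have h := hx (σ.symm ⟨0, by omega⟩)
    rw [Equiv.apply_symm_apply, if_pos rfl] at h
    have habs : |x (σ.symm ⟨0, by omega⟩)| = 1 / Real.sqrt 2 := by
      rw [h, abs_mul, abs_of_pos hs0]
      rcases hε with rfl | rfl <;> simp
    rw [hval _ (abs_pos.mp (habs ▸ hs0)), habs]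
end

section
/- Let d ≥ 3 and q > 2. Suppose x ∈ ℝ^d maximizes F(x) = ∑_{i=1}^d |x_i|^q over the constraint set S, and there exist λ, μ ∈ ℝ with λ ≠ 0 such that q|x_i|^{q−2} x_i = λ + 2μ x_i for all i. Then all coordinates of x are nonzero, and after replacing x by −x if necessary and permuting coordinates, x = (a, −y_1, …, −y_{d−1}) with a > 0 and y_j > 0 for all j; that is, either x or −x has exactly one positive coordinate and all remaining coordinates strictly negative. -/
theorem abs_rpow_eq_sq_rpow_half (z q : ℝ) : |z| ^ q = (z ^ 2) ^ (q / 2) := by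
  rw [← sq_abs, ← Real.rpow_natCast_mul (abs_nonneg z)]
  congr 1
  push_cast
  ring

/-- A second-order lower bound for the symmetric sum `|a + t|^q + |a - t|^q`. -/
theorem two_mul_rpow_add_le_abs_add_rpow_add_abs_sub_rpow {q a : ℝ} (hq : 2 ≤ q) (ha : 0 < a)
    (t : ℝ) : 2 * a ^ q + q * a ^ (q - 2) * t ^ 2 ≤ |a + t| ^ q + |a - t| ^ q := by
  have hconv := (convexOn_rpow (p := q / 2) (by linarith)).2 (Set.mem_Ici.2 (sq_nonneg (a + t)))
    (Set.mem_Ici.2 (sq_nonneg (a - t))) (show (0 : ℝ) ≤ 1 / 2 by norm_num)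
    (show (0 : ℝ) ≤ 1 / 2 by norm_num) (by norm_num)
  simp only [smul_eq_mul] at hconv
  have hbern := one_add_mul_self_le_rpow_one_add (s := t ^ 2 / a ^ 2) (p := q / 2)
    (by linarith [show 0 ≤ t ^ 2 / a ^ 2 by positivity]) (by linarith)
  have hmid : 1 / 2 * (a + t) ^ 2 + 1 / 2 * (a - t) ^ 2 = a ^ 2 * (1 + t ^ 2 / a ^ 2) := by
    field_simp
    ring
  rw [hmid, Real.mul_rpow (by positivity) (by positivity), ← abs_rpow_eq_sq_rpow_half,
    ← abs_rpow_eq_sq_rpow_half, ← abs_rpow_eq_sq_rpow_half, abs_of_pos ha] at hconv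
  have hscaled := mul_le_mul_of_nonneg_left hbern (Real.rpow_pos_of_pos ha q).le
  have hpow : a ^ q = a ^ (q - 2) * a ^ 2 := by
    rw [← Real.rpow_natCast, ← Real.rpow_add ha]
    norm_num
  have hexpand : a ^ q * (1 + q / 2 * (t ^ 2 / a ^ 2)) = a ^ q + q * a ^ (q - 2) * t ^ 2 / 2 := by
    rw [hpow]
    field_simp
  linarith

/-- Two equal positive coordinates `a` of a maximizer satisfy `a ^ (q - 2) ≤ ∑ |x i| ^ q`. -/
theorem rpow_sub_two_le_sum_of_two_coordinates_eq {ι : Type*} [Fintype ι] {q : ℝ} (hq : 2 ≤ q)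
    {x : ι → ℝ} (hsum : ∑ i, x i = 0) (hnorm : ∑ i, x i ^ 2 = 1)
    (hmax : ∀ y : ι → ℝ, ∑ i, y i = 0 → ∑ i, y i ^ 2 = 1 → ∑ i, |y i| ^ q ≤ ∑ i, |x i| ^ q)
    {i j : ι} (hij : i ≠ j) {a : ℝ} (ha : 0 < a) (hi : x i = a) (hj : x j = a) :
    a ^ (q - 2) ≤ ∑ i, |x i| ^ q := by
  classical
  set F := ∑ i, |x i| ^ q with hF
  set A := a ^ (q - 2) with hA
  have hF0 : 0 ≤ F := Finset.sum_nonneg fun i _ => by positivity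
  have hA0 : 0 < A := Real.rpow_pos_of_pos ha _
  by_contra! hFA
  obtain ⟨u, hu0, hu1, huA⟩ : ∃ u, 0 < u ∧ u < 1 ∧ F < A * (1 - q / 2 * u) := by
    refine ⟨(A - F) / (q * A), div_pos (by linarith) (by positivity), ?_, ?_⟩
    · rw [div_lt_one (by positivity)]
      nlinarith
    · have : A * (1 - q / 2 * ((A - F) / (q * A))) = (A + F) / 2 := by
        field_simp
        ring
      linarith
  have hv : 0 < 1 - u := by linarith
  set t := √(u / (2 * (1 - u)))
  have htsq : t ^ 2 = u / (2 * (1 - u)) := Real.sq_sqrt (by positivity)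
  set z : ι → ℝ := fun k => if k = i then a + t else if k = j then a - t else x k with hz
  have hzsum (g : ℝ → ℝ) :
      ∑ k, g (z k) = ∑ k, g (x k) + (g (a + t) + g (a - t) - 2 * g a) := by
    have h := Fintype.sum_eq_add (f := fun k => g (z k) - g (x k)) i j hij (by
      rintro k ⟨hki, hkj⟩
      simp [hz, hki, hkj])
    rw [Finset.sum_sub_distrib] at h
    simp only [hz, if_true, hij.symm, if_false, hi, hj] at h ⊢
    linarith
  set c := √(1 - u)
  have hcsq : c ^ 2 = 1 - u := Real.sq_sqrt hv.le
  have hbern := one_add_mul_self_le_rpow_one_add (s := -u) (p := q / 2) (by linarith)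
    (by linarith)
  have hcq : |c| ^ q = (1 + -u) ^ (q / 2) := by
    rw [abs_rpow_eq_sq_rpow_half, hcsq, sub_eq_add_neg]
  have hy := hmax (fun k => c * z k) (by
      rw [← Finset.mul_sum, hzsum fun r => r, hsum]
      ring) (by
      simp only [mul_pow]
      rw [← Finset.mul_sum, hzsum fun r => r ^ 2, hnorm, hcsq]
      have : (1 - u) * (1 + 2 * t ^ 2) = 1 := by
        rw [htsq]
        field_simp
        ring
      linear_combination this)
  simp only [abs_mul, Real.mul_rpow (abs_nonneg _) (abs_nonneg _)] at hy
  rw [← Finset.mul_sum, hzsum fun r => |r| ^ q, hcq, ← hF, abs_of_pos ha] at hy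
  have hpair := two_mul_rpow_add_le_abs_add_rpow_add_abs_sub_rpow hq ha t
  rw [← hA] at hpair
  have hfactor : 0 < 1 - q / 2 * u := pos_of_mul_pos_right (hF0.trans_lt huA) hA0.le
  have hle : (1 - q / 2 * u) * (F + q * A * t ^ 2) ≤ F := by
    refine le_trans (mul_le_mul (by linarith) (by linarith) (by positivity) ?_) hy
    exact Real.rpow_nonneg (by linarith) _
  have hprod : 2 * t ^ 2 * (1 - u) = u := by
    rw [htsq]
    field_simp
  have ht0 : u ≤ 2 * t ^ 2 := by nlinarith [sq_nonneg t]
  have hqt : 0 < q * t ^ 2 := by nlinarith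
  nlinarith [mul_lt_mul_of_pos_left huA hqt, mul_nonneg hF0 (sub_nonneg.2 ht0)]

/-- For a positive multiplier `lam`, a maximizer has exactly one positive coordinate. -/
theorem existsUnique_pos_coordinate_of_multiplier_pos {ι : Type*} [Fintype ι] {q : ℝ} (hq : 2 < q)
    {x : ι → ℝ} (hsum : ∑ i, x i = 0) (hnorm : ∑ i, x i ^ 2 = 1)
    (hmax : ∀ y : ι → ℝ, ∑ i, y i = 0 → ∑ i, y i ^ 2 = 1 → ∑ i, |y i| ^ q ≤ ∑ i, |x i| ^ q)
    {lam mu : ℝ} (hlam : 0 < lam) (hEL : ∀ i, q * |x i| ^ (q - 2) * x i = lam + 2 * mu * x i) :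
    ∃! i, 0 < x i := by
  have hmu : q * ∑ i, |x i| ^ q = 2 * mu := by
    have hterm (i : ι) : q * |x i| ^ q = lam * x i + 2 * mu * x i ^ 2 := by
      have hpow : |x i| ^ q = |x i| ^ (q - 2) * x i ^ 2 := by
        rw [← sq_abs (x i), ← Real.rpow_natCast, ← Real.rpow_add' (abs_nonneg _)] <;>
          norm_num
        linarith
      rw [hpow]
      linear_combination x i * hEL i
    rw [Finset.mul_sum, Finset.sum_congr rfl fun i _ => hterm i, Finset.sum_add_distrib,
      ← Finset.mul_sum, ← Finset.mul_sum, hsum, hnorm]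
    ring
  have hEL' (i : ι) (hi : 0 < x i) : q * x i ^ (q - 2) = lam / x i + 2 * mu := by
    have h := hEL i
    rw [abs_of_pos hi] at h
    field_simp
    linarith
  have hnot_lt (i j : ι) (hi : 0 < x i) (hj : 0 < x j) : ¬ x i < x j := fun hij => by
    have h1 := Real.rpow_lt_rpow hi.le hij (show 0 < q - 2 by linarith)
    have h2 := div_lt_div_of_pos_left hlam hi hij
    nlinarith [hEL' i hi, hEL' j hj]
  obtain ⟨i, hi⟩ : ∃ i, 0 < x i := by
    by_contra! hneg
    have hzero := (Finset.sum_eq_zero_iff_of_nonpos fun i _ => hneg i).1 hsum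
    simp [fun i => hzero i (Finset.mem_univ i)] at hnorm
  refine ⟨i, hi, fun j hj => ?_⟩
  by_contra hji
  have heq : x j = x i := le_antisymm (not_lt.1 (hnot_lt i j hi hj)) (not_lt.1 (hnot_lt j i hj hi))
  have hle := rpow_sub_two_le_sum_of_two_coordinates_eq hq.le hsum hnorm hmax hji hi heq rfl
  nlinarith [hEL' i hi, div_pos hlam hi]


/-- Structure of maximizers, case `q > 2`: if `x` maximizes `∑ |x_i|^q` over the
constraint set `S = {∑ x_i = 0, ∑ x_i² = 1}` and satisfies the Euler–Lagrange equations
with `λ ≠ 0`, then all coordinates are nonzero and, up to a global sign, `x` has exactly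
one positive coordinate, all remaining coordinates being strictly negative. -/
theorem one_positive_coordinate_q (d : ℕ) (hd : 3 ≤ d) (q : ℝ) (hq : 2 < q)
    (x : Fin d → ℝ) (hsum : (∑ i, x i) = 0) (hnorm : (∑ i, (x i) ^ 2) = 1)
    (hmax : ∀ y : Fin d → ℝ, (∑ i, y i) = 0 → (∑ i, (y i) ^ 2) = 1 →
      (∑ i, |y i| ^ q) ≤ ∑ i, |x i| ^ q)
    (lam mu : ℝ) (hlam : lam ≠ 0)
    (hEL : ∀ i, q * |x i| ^ (q - 2) * x i = lam + 2 * mu * x i) :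
    (∀ i, x i ≠ 0) ∧
      ∃ ε : ℝ, (ε = 1 ∨ ε = -1) ∧ ∃ i₀ : Fin d,
        0 < ε * x i₀ ∧ ∀ i, i ≠ i₀ → ε * x i < 0 := by
  have hne : ∀ i, x i ≠ 0 := fun i hi => hlam (by simpa [hi] using (hEL i).symm)
  refine ⟨hne, ?_⟩
  rcases hlam.lt_or_gt with hneg | hpos
  · obtain ⟨i₀, hi₀, huniq⟩ := existsUnique_pos_coordinate_of_multiplier_pos (x := fun i => -x i)
      (lam := -lam) (mu := mu) hq (by simp [hsum]) (by simp [hnorm]) (by simpa using hmax)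
      (by linarith) (fun i => by
        rw [abs_neg]
        linear_combination -hEL i)
    refine ⟨-1, Or.inr rfl, i₀, by simpa using hi₀, fun i hi => ?_⟩
    have h := mt (huniq i) hi
    have := (hne i).lt_or_gt
    grind
  · obtain ⟨i₀, hi₀, huniq⟩ :=
      existsUnique_pos_coordinate_of_multiplier_pos hq hsum hnorm hmax hpos hEL
    refine ⟨1, Or.inl rfl, i₀, by simpa using hi₀, fun i hi => ?_⟩
    rw [one_mul]
    exact lt_of_le_of_ne (not_lt.1 (mt (huniq i) hi)) (hne i)
end

section
/- Let d ≥ 3, n = d − 1, and q > 2. Suppose x ∈ ℝ^d maximizes F(x) = ∑_{i=1}^d |x_i|^q over the constraint set S, that x = (a, −y_1, …, −y_n) with a > 0 and y_j > 0 for all j, and that there exist λ, μ ∈ ℝ with λ ≠ 0 such that q|x_i|^{q−2} x_i = λ + 2μ x_i for all i. Then, after a permutation of the y_j's, (y_1, …, y_n) = (b, c, …, c) for some b ≥ c > 0; that is, the values y_1, …, y_n take at most two distinct values and the larger value occurs exactly once whenever two distinct values occur. -/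
/-- A maximizer of the `q`-homogeneous sum over the constraint set bounds that sum on the whole
hyperplane `∑ z i = 0`. -/
theorem sum_abs_rpow_le_of_isMax {ι : Type*} [Fintype ι] {q G : ℝ}
    (hmax : ∀ y : ι → ℝ, (∑ i, y i) = 0 → (∑ i, (y i) ^ 2) = 1 → (∑ i, |y i| ^ q) ≤ G)
    {z : ι → ℝ} (hsum : ∑ i, z i = 0) (hpos : 0 < ∑ i, z i ^ 2) :
    ∑ i, |z i| ^ q ≤ G * (∑ i, z i ^ 2) ^ (q / 2) := by
  set N := ∑ i, z i ^ 2 with hN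
  have hr : 0 < √N := Real.sqrt_pos.2 hpos
  have hrq : (√N) ^ q = N ^ (q / 2) := by
    rw [Real.sqrt_eq_rpow, ← Real.rpow_mul hpos.le]
    congr 1
    ring
  have h := hmax (fun i => z i / √N)
    (by rw [← Finset.sum_div, hsum, zero_div])
    (by
      simp only [div_pow, Real.sq_sqrt hpos.le]
      rw [← Finset.sum_div, ← hN, div_self hpos.ne'])
  have habs : ∀ i, |z i / √N| ^ q = |z i| ^ q / N ^ (q / 2) := fun i => by
    rw [abs_div, abs_of_pos hr, Real.div_rpow (abs_nonneg _) hr.le, hrq]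
  simp only [habs] at h
  rwa [← Finset.sum_div, div_le_iff₀ (Real.rpow_pos_of_pos hpos _)] at h

theorem sum_comp_eq_add_of_eqOn {ι : Type*} [Fintype ι] (g : ℝ → ℝ) {x z : ι → ℝ} {j k : ι}
    (hjk : j ≠ k) (h : ∀ i, i ≠ j → i ≠ k → z i = x i) :
    ∑ i, g (z i) = ∑ i, g (x i) + ((g (z j) - g (x j)) + (g (z k) - g (x k))) := by
  rw [← Fintype.sum_eq_add (f := fun i => g (z i) - g (x i)) j k hjk
    (fun i hi => by rw [h i hi.1 hi.2, sub_self]), Finset.sum_sub_distrib]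
  ring

/-- Second-order condition at `t = 0` for the variation splitting two equal coordinates `b`. -/
theorem rpow_le_of_forall_split {q b G : ℝ} (hb : 0 < b) (hq : 0 < q)
    (h : ∀ t : ℝ, |t| < b →
      G + ((b + t) ^ q + (b - t) ^ q - 2 * b ^ q) ≤ G * (1 + 2 * t ^ 2) ^ (q / 2)) :
    (q - 1) * b ^ (q - 2) ≤ G := by
  by_contra! hlt
  set f : ℝ → ℝ := fun t => G * (1 + 2 * t ^ 2) ^ (q / 2) - (b + t) ^ q - (b - t) ^ q with hf
  set f' : ℝ → ℝ := fun t => G * (4 * t * (q / 2) * (1 + 2 * t ^ 2) ^ (q / 2 - 1))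
    - q * (b + t) ^ (q - 1) + q * (b - t) ^ (q - 1) with hf'
  have hnhds : ∀ᶠ t : ℝ in nhds 0, |t| < b :=
    continuous_abs.continuousAt.eventually_lt continuousAt_const (by simpa using hb)
  have hquad : ∀ t : ℝ, HasDerivAt (fun t : ℝ => 1 + 2 * t ^ 2) (4 * t) t := fun t => by
    have := ((hasDerivAt_pow 2 t).const_mul 2).const_add 1
    refine this.congr_deriv ?_
    norm_num
    ring
  have hplus : ∀ t : ℝ, HasDerivAt (fun t : ℝ => b + t) 1 t := fun t =>
    (hasDerivAt_id t).const_add b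
  have hminus : ∀ t : ℝ, HasDerivAt (fun t : ℝ => b - t) (-1) t := fun t =>
    (hasDerivAt_id t).const_sub b
  have hderiv : ∀ t : ℝ, |t| < b → HasDerivAt f (f' t) t := fun t ht => by
    obtain ⟨h1, h2⟩ := abs_lt.1 ht
    have h3 : (1 + 2 * t ^ 2) ≠ 0 := by positivity
    have := ((((hquad t).rpow_const (p := q / 2) (Or.inl h3)).const_mul G).sub
      ((hplus t).rpow_const (p := q) (Or.inl (by linarith)))).sub
      ((hminus t).rpow_const (p := q) (Or.inl (by linarith)))
    refine this.congr_deriv ?_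
    simp only [hf']
    ring
  have hderiv' : HasDerivAt f' (2 * q * (G - (q - 1) * b ^ (q - 2))) 0 := by
    have h3 : (1 + 2 * (0 : ℝ) ^ 2) ≠ 0 := by norm_num
    have := ((((((hasDerivAt_id (0 : ℝ)).const_mul 4).mul_const (q / 2)).mul
      ((hquad 0).rpow_const (p := q / 2 - 1) (Or.inl h3))).const_mul G).sub
      (((hplus 0).rpow_const (p := q - 1) (Or.inl (by linarith))).const_mul q)).add
      (((hminus 0).rpow_const (p := q - 1) (Or.inl (by linarith))).const_mul q)
    refine this.congr_deriv ?_
    have he : q - 1 - 1 = q - 2 := by ring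
    simp [he]
    ring
  have hdf : deriv f =ᶠ[nhds 0] f' := hnhds.mono fun t ht => (hderiv t ht).deriv
  have hdd : deriv (deriv f) 0 = 2 * q * (G - (q - 1) * b ^ (q - 2)) := by
    rw [hdf.deriv_eq, hderiv'.deriv]
  have hneg : deriv (deriv f) 0 < 0 := by
    rw [hdd]
    exact mul_neg_of_pos_of_neg (by positivity) (by linarith)
  have hlmax : IsLocalMax f 0 := isLocalMax_of_deriv_deriv_neg hneg
    (by rw [hdf.eq_of_nhds]; simp [hf']) (hderiv 0 (by simpa using hb)).continuousAt
  have hconst : f =ᶠ[nhds 0] fun _ => f 0 := by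
    filter_upwards [hlmax, hnhds] with t ht htb
    refine le_antisymm ht ?_
    have := h t htb
    simp only [hf]
    norm_num
    linarith
  have hzero : deriv (deriv f) 0 = 0 := by
    rw [hconst.deriv.deriv_eq]
    simp
  linarith

/-- Two positive coordinates of equal absolute value give the second-order condition. -/
theorem rpow_le_sum_of_isMax {ι : Type*} [Fintype ι] {q b : ℝ} (hq : 0 < q)
    {x : ι → ℝ} (hsum : (∑ i, x i) = 0) (hnorm : (∑ i, (x i) ^ 2) = 1)
    (hmax : ∀ y : ι → ℝ, (∑ i, y i) = 0 → (∑ i, (y i) ^ 2) = 1 →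
      (∑ i, |y i| ^ q) ≤ ∑ i, |x i| ^ q)
    {j k : ι} (hjk : j ≠ k) (hb : 0 < b) (hj : x j = -b) (hk : x k = -b) :
    (q - 1) * b ^ (q - 2) ≤ ∑ i, |x i| ^ q := by
  classical
  refine rpow_le_of_forall_split hb hq fun t ht => ?_
  obtain ⟨h1, h2⟩ := abs_lt.1 ht
  set z : ι → ℝ := Function.update (Function.update x j (-(b + t))) k (-(b - t)) with hz
  have hzj : z j = -(b + t) := by simp [hz, hjk]
  have hzk : z k = -(b - t) := by simp [hz]
  have hzi : ∀ i, i ≠ j → i ≠ k → z i = x i := fun i hij hik => by simp [hz, hij, hik]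
  have hzsum : ∑ i, z i = 0 := by
    have := sum_comp_eq_add_of_eqOn (fun s => s) hjk hzi
    rw [this, hsum, hzj, hzk, hj, hk]
    ring
  have hzsq : ∑ i, z i ^ 2 = 1 + 2 * t ^ 2 := by
    have := sum_comp_eq_add_of_eqOn (fun s => s ^ 2) hjk hzi
    rw [this, hnorm, hzj, hzk, hj, hk]
    ring
  have hzq := sum_comp_eq_add_of_eqOn (fun s => |s| ^ q) hjk hzi
  have hle := sum_abs_rpow_le_of_isMax hmax hzsum (by rw [hzsq]; positivity)
  rw [hzsq, hzq] at hle
  simp only [hzj, hzk, hj, hk, abs_neg] at hle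
  rw [abs_of_pos hb, abs_of_pos (by linarith : 0 < b + t),
    abs_of_pos (by linarith : 0 < b - t)] at hle
  linarith

theorem rpow_sub_rpow_lt {p b c : ℝ} (hp : 1 < p) (hc : 0 < c) (hcb : c < b) :
    b ^ p - c ^ p < p * b ^ (p - 1) * (b - c) := by
  have hb := hc.trans hcb
  have h := (strictConvexOn_rpow hp).slope_lt_of_hasDerivAt (x := c) (y := b)
    hc.le hb.le hcb (Real.hasDerivAt_rpow_const (Or.inl hb.ne'))
  rwa [slope_def_field, div_lt_iff₀ (sub_pos.2 hcb)] at h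


/-- Structure of the negative coordinates, case `q > 2`: if `x = (a, -y_1, …, -y_{d-1})`
with `a > 0`, `y_j > 0` maximizes `∑ |x_i|^q` over the constraint set and satisfies the
Euler–Lagrange equations with `λ ≠ 0`, then after a permutation `(y_1,…,y_{d-1}) = (b,c,…,c)`
for some `b ≥ c > 0`. -/
theorem negative_coordinates_structure_q (d : ℕ) (hd : 3 ≤ d) (q : ℝ) (hq : 2 < q)
    (x : Fin d → ℝ)
    (hsum : (∑ i, x i) = 0) (hnorm : (∑ i, (x i) ^ 2) = 1)
    (hmax : ∀ y : Fin d → ℝ, (∑ i, y i) = 0 → (∑ i, (y i) ^ 2) = 1 →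
      (∑ i, |y i| ^ q) ≤ ∑ i, |x i| ^ q)
    (ha : 0 < x (⟨0, by omega⟩ : Fin d))
    (hy : ∀ i : Fin d, i ≠ (⟨0, by omega⟩ : Fin d) → x i < 0)
    (lam mu : ℝ) (hlam : lam ≠ 0)
    (hEL : ∀ i, q * |x i| ^ (q - 2) * x i = lam + 2 * mu * x i) :
    ∃ b c : ℝ, c ≤ b ∧ 0 < c ∧ ∃ i₀ : Fin d, i₀ ≠ (⟨0, by omega⟩ : Fin d) ∧ x i₀ = -b ∧
      ∀ i : Fin d, i ≠ (⟨0, by omega⟩ : Fin d) → i ≠ i₀ → x i = -c := by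
  set o : Fin d := ⟨0, by omega⟩ with ho
  set G := ∑ i, |x i| ^ q with hG
  have hmu : 2 * mu = q * G := by
    have hterm : ∀ i, q * |x i| ^ q = lam * x i + 2 * mu * x i ^ 2 := fun i => by
      have hi : x i ≠ 0 := by
        by_cases h : i = o
        · exact h ▸ ha.ne'
        · exact (hy i h).ne
      have hsplit : |x i| ^ q = |x i| ^ (q - 2) * x i ^ 2 := by
        rw [← sq_abs, ← Real.rpow_natCast, ← Real.rpow_add (abs_pos.2 hi)]
        congr 1
        norm_num
      rw [hsplit]
      linear_combination x i * hEL i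
    have := Finset.sum_congr rfl fun i (_ : i ∈ Finset.univ) => hterm i
    rw [← Finset.mul_sum, Finset.sum_add_distrib, ← Finset.mul_sum, ← Finset.mul_sum, hsum,
      hnorm] at this
    linarith
  have hpow : ∀ i, i ≠ o → (-x i) ^ (q - 1) = G * (-x i) - lam / q := fun i hi => by
    have hpos : 0 < -x i := neg_pos.2 (hy i hi)
    have hE := hEL i
    rw [hmu, abs_of_neg (hy i hi)] at hE
    have hsplit : (-x i) ^ (q - 1) = (-x i) ^ (q - 2) * (-x i) := by
      rw [← Real.rpow_add_one hpos.ne']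
      congr 1
      ring
    rw [hsplit]
    field_simp
    linarith
  have hno : ∀ i j k, i ≠ o → j ≠ o → k ≠ o → i ≠ j → x i ≤ x j → x j < x k → False := by
    intro i j k hi hj hk hij hle hlt
    have hxj := hy j hj
    have hxk := hy k hk
    rcases hle.eq_or_lt with heq | hlt'
    · have h2 := rpow_le_sum_of_isMax (by linarith) hsum hnorm hmax hij (neg_pos.2 hxj)
        (by rw [heq, neg_neg]) (neg_neg _).symm
      have h1 := rpow_sub_rpow_lt (p := q - 1) (by linarith) (neg_pos.2 hxk) (neg_lt_neg hlt)
      rw [hpow j hj, hpow k hk, show q - 1 - 1 = q - 2 by ring] at h1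
      nlinarith [mul_le_mul_of_nonneg_right h2 (sub_pos.2 hlt).le]
    · have hs := (strictConvexOn_rpow (p := q - 1) (by linarith)).slope_strict_mono_adjacent
        (Set.mem_Ici.2 (neg_pos.2 hxk).le) (Set.mem_Ici.2 (neg_pos.2 (hy i hi)).le)
        (neg_lt_neg hlt) (neg_lt_neg hlt')
      rw [hpow i hi, hpow j hj, hpow k hk, div_lt_div_iff₀ (by linarith) (by linarith)] at hs
      linarith
  have hne : (Finset.univ.erase o).Nonempty :=
    ⟨⟨1, by omega⟩, by simp [ho]⟩
  obtain ⟨i₀, hi₀, hmin⟩ := Finset.exists_min_image (Finset.univ.erase o) x hne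
  have hi₀o : i₀ ≠ o := Finset.ne_of_mem_erase hi₀
  have hmin' : ∀ i, i ≠ o → x i₀ ≤ x i := fun i hi => hmin i (by simp [hi])
  obtain ⟨k, hk⟩ : ∃ k, k ∉ ({o, i₀} : Finset (Fin d)) := by
    by_contra! hall
    have h1 := Finset.card_le_card (fun i _ => hall i : Finset.univ ⊆ ({o, i₀} : Finset (Fin d)))
    have h2 := Finset.card_le_two (a := o) (b := i₀)
    rw [Finset.card_univ, Fintype.card_fin] at h1
    omega
  simp only [Finset.mem_insert, Finset.mem_singleton, not_or] at hk
  refine ⟨-x i₀, -x k, neg_le_neg (hmin' k hk.1), neg_pos.2 (hy k hk.1), i₀, hi₀o,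
    (neg_neg _).symm, fun i hi hii₀ => ?_⟩
  rw [neg_neg]
  rcases lt_trichotomy (x i) (x k) with h | h | h
  · exact (hno i₀ i k hi₀o hi hk.1 (Ne.symm hii₀) (hmin' i hi) h).elim
  · exact h
  · exact (hno i₀ k i hi₀o hk.1 hi (Ne.symm hk.2) (hmin' k hk.1) h).elim
end

section
/- Let ℓ = 1 and for r > 0 define Ψ_r(w) = ((1+w)^r + 1 + w^r) / (2 + 2w + 2w²)^{r/2} for w ∈ [0,1]. Then Ψ_r is strictly increasing on [0,1] for 1 < r < 2 and for r > 4, strictly decreasing on [0,1] for 2 < r < 4, and Ψ_2(w) = 1 and Ψ_4(w) = 1/2 identically on [0,1]. In particular, for every r > 0 the extrema of Ψ_r on [0,1] are attained at the endpoints. -/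
/-- The function of the exponent whose sign at `s = r - 1` is that of `Ψ_r'(w)`. -/
noncomputable def psiSign (w s : ℝ) : ℝ :=
  (1 - w) * (1 + w) ^ s + (2 + w) * w ^ s - (1 + 2 * w)

theorem strictConvexOn_const_rpow {a : ℝ} (ha : 0 < a) (ha1 : a ≠ 1) :
    StrictConvexOn ℝ Set.univ (fun s : ℝ => a ^ s) := by
  refine ⟨convex_univ, fun x _ y _ hxy c d hc hd hcd => ?_⟩
  have hlog : Real.log a ≠ 0 := Real.log_ne_zero_of_pos_of_ne_one ha ha1
  have h := strictConvexOn_exp.2 (Set.mem_univ (Real.log a * x)) (Set.mem_univ (Real.log a * y))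
    (fun h => hxy (mul_left_cancel₀ hlog h)) hc hd hcd
  simp only [Real.rpow_def_of_pos ha, smul_eq_mul] at h ⊢
  convert h using 2
  ring

theorem strictConvexOn_psiSign {w : ℝ} (h0 : 0 < w) (h1 : w < 1) :
    StrictConvexOn ℝ Set.univ (psiSign w) := by
  refine ⟨convex_univ, fun x hx y hy hxy c d hc hd hcd => ?_⟩
  have hA := (strictConvexOn_const_rpow (by linarith : 0 < 1 + w) (by linarith)).2
    hx hy hxy hc hd hcd
  have hB := (strictConvexOn_const_rpow h0 h1.ne).2 hx hy hxy hc hd hcd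
  simp only [smul_eq_mul, psiSign] at *
  have hA' := mul_lt_mul_of_pos_left hA (sub_pos.2 h1)
  have hB' := mul_lt_mul_of_pos_left hB (by linarith : 0 < 2 + w)
  have hconst : 1 + 2 * w = c * (1 + 2 * w) + d * (1 + 2 * w) := by rw [← add_mul, hcd, one_mul]
  linarith

theorem psiSign_one (w : ℝ) : psiSign w 1 = 0 := by
  simp only [psiSign, Real.rpow_one]; ring

theorem psiSign_three (w : ℝ) : psiSign w 3 = 0 := by
  have h (x : ℝ) : x ^ (3 : ℝ) = x ^ 3 := by exact_mod_cast Real.rpow_natCast x 3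
  simp only [psiSign, h]; ring

theorem psiSign_pos_of_lt_one {w s : ℝ} (h0 : 0 < w) (h1 : w < 1) (hs : s < 1) :
    0 < psiSign w s := by
  have h := (strictConvexOn_psiSign h0 h1).slope_strict_mono_adjacent (Set.mem_univ s)
    (Set.mem_univ 3) hs (by norm_num)
  rw [psiSign_one, psiSign_three, sub_self, zero_div, div_lt_iff₀ (by linarith)] at h
  linarith

theorem psiSign_pos_of_three_lt {w s : ℝ} (h0 : 0 < w) (h1 : w < 1) (hs : 3 < s) :
    0 < psiSign w s := by
  have h := (strictConvexOn_psiSign h0 h1).slope_strict_mono_adjacent (Set.mem_univ 1)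
    (Set.mem_univ s) (by norm_num) hs
  rw [psiSign_one, psiSign_three, sub_self, zero_div, lt_div_iff₀ (by linarith)] at h
  linarith

theorem psiSign_neg {w s : ℝ} (h0 : 0 < w) (h1 : w < 1) (hs : 1 < s) (hs' : s < 3) :
    psiSign w s < 0 := by
  have h := (strictConvexOn_psiSign h0 h1).slope_strict_mono_adjacent (Set.mem_univ 1)
    (Set.mem_univ 3) hs hs'
  rw [psiSign_one, psiSign_three, div_lt_div_iff₀ (by linarith) (by linarith)] at h
  nlinarith

theorem Psi_one_eq (r : ℝ) :
    Psi 1 r = fun w : ℝ => ((1 + w) ^ r + 1 + w ^ r) / (2 + 2 * w + 2 * w ^ 2) ^ (r / 2) := by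
  funext w
  norm_num [Psi]

theorem two_add_two_mul_add_pos (w : ℝ) : 0 < 2 + 2 * w + 2 * w ^ 2 := by
  nlinarith [sq_nonneg (1 + w), sq_nonneg w]

theorem hasDerivAt_Psi_one (r : ℝ) {w : ℝ} (h0 : 0 < w) :
    HasDerivAt (Psi 1 r)
      (r * (2 + 2 * w + 2 * w ^ 2) ^ (r / 2 - 1) / ((2 + 2 * w + 2 * w ^ 2) ^ (r / 2)) ^ 2
        * psiSign w (r - 1)) w := by
  rw [Psi_one_eq]
  have hD := two_add_two_mul_add_pos w
  have hw1 : 0 < 1 + w := by linarith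
  have hnum : HasDerivAt (fun w : ℝ => (1 + w) ^ r + 1 + w ^ r)
      (1 * r * (1 + w) ^ (r - 1) + 1 * r * w ^ (r - 1)) w :=
    ((((hasDerivAt_id w).const_add 1).rpow_const (Or.inl hw1.ne')).add_const 1).add
      ((hasDerivAt_id w).rpow_const (Or.inl h0.ne'))
  have hbase : HasDerivAt (fun w : ℝ => 2 + 2 * w + 2 * w ^ 2) (2 + 4 * w) w := by
    have h := (((hasDerivAt_id w).const_mul 2).const_add 2).add
      (((hasDerivAt_id w).pow 2).const_mul 2)
    refine h.congr_deriv ?_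
    simp
    ring
  refine (hnum.div (hbase.rpow_const (p := r / 2) (Or.inl hD.ne'))
    (Real.rpow_pos_of_pos hD _).ne').congr_deriv ?_
  rw [div_mul_eq_mul_div]
  congr 1
  have e1 : (1 + w) ^ r = (1 + w) ^ (r - 1) * (1 + w) := by
    rw [← Real.rpow_add_one hw1.ne', sub_add_cancel]
  have e2 : w ^ r = w ^ (r - 1) * w := by rw [← Real.rpow_add_one h0.ne', sub_add_cancel]
  have e3 : (2 + 2 * w + 2 * w ^ 2) ^ (r / 2)
      = (2 + 2 * w + 2 * w ^ 2) ^ (r / 2 - 1) * (2 + 2 * w + 2 * w ^ 2) := by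
    rw [← Real.rpow_add_one hD.ne', sub_add_cancel]
  rw [e1, e2, e3, psiSign]
  ring

theorem continuous_Psi_one {r : ℝ} (hr : 0 < r) : Continuous (Psi 1 r) := by
  rw [Psi_one_eq]
  refine Continuous.div ?_ ?_ fun w => (Real.rpow_pos_of_pos (two_add_two_mul_add_pos w) _).ne'
  · exact (((continuous_const.add continuous_id).rpow_const fun _ => Or.inr hr.le).add
      continuous_const).add (continuous_id.rpow_const fun _ => Or.inr hr.le)
  · exact (by fun_prop : Continuous fun w : ℝ => 2 + 2 * w + 2 * w ^ 2).rpow_const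
      fun w => Or.inl (two_add_two_mul_add_pos w).ne'

theorem Psi_one_coeff_pos {r : ℝ} (hr : 0 < r) (w : ℝ) :
    0 < r * (2 + 2 * w + 2 * w ^ 2) ^ (r / 2 - 1) / ((2 + 2 * w + 2 * w ^ 2) ^ (r / 2)) ^ 2 := by
  have hD := two_add_two_mul_add_pos w
  positivity

theorem strictMonoOn_Psi_one {r : ℝ} (hr : 0 < r)
    (h : ∀ w : ℝ, 0 < w → w < 1 → 0 < psiSign w (r - 1)) :
    StrictMonoOn (Psi 1 r) (Set.Icc 0 1) := by
  refine strictMonoOn_of_deriv_pos (convex_Icc 0 1) (continuous_Psi_one hr).continuousOn ?_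
  rw [interior_Icc]
  intro w hw
  rw [(hasDerivAt_Psi_one r hw.1).deriv]
  exact mul_pos (Psi_one_coeff_pos hr w) (h w hw.1 hw.2)

theorem strictMonoOn_Psi_one_of_lt_two {r : ℝ} (hr : 0 < r) (hr2 : r < 2) :
    StrictMonoOn (Psi 1 r) (Set.Icc 0 1) :=
  strictMonoOn_Psi_one hr fun _ h0 h1 => psiSign_pos_of_lt_one h0 h1 (by linarith)

theorem strictMonoOn_Psi_one_of_four_lt {r : ℝ} (hr : 4 < r) :
    StrictMonoOn (Psi 1 r) (Set.Icc 0 1) :=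
  strictMonoOn_Psi_one (by linarith) fun _ h0 h1 => psiSign_pos_of_three_lt h0 h1 (by linarith)

theorem strictAntiOn_Psi_one {r : ℝ} (hr : 2 < r) (hr4 : r < 4) :
    StrictAntiOn (Psi 1 r) (Set.Icc 0 1) := by
  have hr0 : 0 < r := by linarith
  refine strictAntiOn_of_deriv_neg (convex_Icc 0 1) (continuous_Psi_one hr0).continuousOn ?_
  rw [interior_Icc]
  intro w hw
  rw [(hasDerivAt_Psi_one r hw.1).deriv]
  exact mul_neg_of_pos_of_neg (Psi_one_coeff_pos hr0 w)
    (psiSign_neg hw.1 hw.2 (by linarith) (by linarith))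

theorem Psi_one_two (w : ℝ) : Psi 1 2 w = 1 := by
  have hD := two_add_two_mul_add_pos w
  simp only [Psi_one_eq, Real.rpow_two, div_self (two_ne_zero' ℝ), Real.rpow_one]
  rw [div_eq_one_iff_eq hD.ne']
  ring

theorem Psi_one_four (w : ℝ) : Psi 1 4 w = 1 / 2 := by
  have hD := two_add_two_mul_add_pos w
  have h (x : ℝ) : x ^ (4 : ℝ) = x ^ 4 := by exact_mod_cast Real.rpow_natCast x 4
  simp only [Psi_one_eq, h, (by norm_num : (4 : ℝ) / 2 = 2), Real.rpow_two]
  rw [div_eq_div_iff (pow_pos hD 2).ne' two_ne_zero]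
  ring

theorem MonotoneOn.min_le_and_le_max {f : ℝ → ℝ} {a b w : ℝ} (hf : MonotoneOn f (Set.Icc a b))
    (hw : w ∈ Set.Icc a b) : min (f a) (f b) ≤ f w ∧ f w ≤ max (f a) (f b) :=
  have hab := hw.1.trans hw.2
  ⟨min_le_of_left_le (hf (Set.left_mem_Icc.2 hab) hw hw.1),
    le_max_of_le_right (hf hw (Set.right_mem_Icc.2 hab) hw.2)⟩

theorem AntitoneOn.min_le_and_le_max {f : ℝ → ℝ} {a b w : ℝ} (hf : AntitoneOn f (Set.Icc a b))
    (hw : w ∈ Set.Icc a b) : min (f a) (f b) ≤ f w ∧ f w ≤ max (f a) (f b) :=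
  have hab := hw.1.trans hw.2
  ⟨min_le_of_right_le (hf hw (Set.right_mem_Icc.2 hab) hw.2),
    le_max_of_le_left (hf (Set.left_mem_Icc.2 hab) hw hw.1)⟩

/-- For `ℓ = 1`: `Ψ_r` is strictly increasing on `[0,1]` for `1 < r < 2` and for `r > 4`,
strictly decreasing on `[0,1]` for `2 < r < 4`, and `Ψ_2 ≡ 1` and `Ψ_4 ≡ 1/2` on `[0,1]`.
In particular, for every `r > 0` the extrema of `Ψ_r` on `[0,1]` are attained at the
endpoints. -/
theorem psi_ell_one :
    (∀ r : ℝ, 1 < r → r < 2 → StrictMonoOn (Psi 1 r) (Set.Icc 0 1)) ∧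
    (∀ r : ℝ, 4 < r → StrictMonoOn (Psi 1 r) (Set.Icc 0 1)) ∧
    (∀ r : ℝ, 2 < r → r < 4 → StrictAntiOn (Psi 1 r) (Set.Icc 0 1)) ∧
    (∀ w ∈ Set.Icc (0 : ℝ) 1, Psi 1 2 w = 1) ∧
    (∀ w ∈ Set.Icc (0 : ℝ) 1, Psi 1 4 w = 1 / 2) ∧
    (∀ r : ℝ, 0 < r → ∀ w ∈ Set.Icc (0 : ℝ) 1,
      min (Psi 1 r 0) (Psi 1 r 1) ≤ Psi 1 r w ∧ Psi 1 r w ≤ max (Psi 1 r 0) (Psi 1 r 1)) := by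
  refine ⟨fun r hr hr2 => strictMonoOn_Psi_one_of_lt_two (by linarith) hr2,
    fun r hr => strictMonoOn_Psi_one_of_four_lt hr, fun r hr hr4 => strictAntiOn_Psi_one hr hr4,
    fun w _ => Psi_one_two w, fun w _ => Psi_one_four w, fun r hr w hw => ?_⟩
  rcases lt_trichotomy r 2 with h2 | rfl | h2
  · exact (strictMonoOn_Psi_one_of_lt_two hr h2).monotoneOn.min_le_and_le_max hw
  · simp [Psi_one_two]
  rcases lt_trichotomy r 4 with h4 | rfl | h4
  · exact (strictAntiOn_Psi_one h2 h4).antitoneOn.min_le_and_le_max hw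
  · simp [Psi_one_four]
  · exact (strictMonoOn_Psi_one_of_four_lt h4).monotoneOn.min_le_and_le_max hw
end

section
/- Let ℓ ≥ 2 be an integer and r ≥ 3 a real number. Then the function Ψ_r(w) = ((1+ℓw)^r + 1 + ℓ w^r) / (2 + 2ℓw + ℓ(ℓ+1)w²)^{r/2} is strictly increasing on [0,1]. -/
/-- For `s ≥ 2`, the convex function `s ↦ a ^ s` lies above its chord through `1` and `2`. -/
theorem rpow_ge_chord {a s : ℝ} (ha : 0 < a) (hs : 2 ≤ s) :
    a + (s - 1) * (a ^ 2 - a) ≤ a ^ s := by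
  have h := one_add_mul_self_le_rpow_one_add (s := a - 1) (by linarith) (p := s - 1) (by linarith)
  rw [add_sub_cancel, Real.rpow_sub_one ha.ne', le_div_iff₀ ha] at h
  linarith

/-- Positivity of the exponential sum that governs the sign of the derivative of `Psi`. -/
theorem rpow_combination_pos {l w s : ℝ} (hl : 2 ≤ l) (hw : 0 < w) (hw1 : w < 1) (hs : 2 ≤ s) :
    0 < (1 - w) * (1 + l * w) ^ s + (2 + l * w) * w ^ s - (1 + l * w + w) := by
  have hlw : 0 < l * w := by positivity
  have hA := mul_le_mul_of_nonneg_left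
    (rpow_ge_chord (a := 1 + l * w) (by linarith) hs) (sub_nonneg.2 hw1.le)
  have hW := mul_le_mul_of_nonneg_left (rpow_ge_chord hw hs) (by linarith : 0 ≤ 2 + l * w)
  have hpos : 0 < (s - 1) * (w * ((1 - w) * ((1 + l * w) * (l - 1) - 1))) := by
    have : 0 < (1 + l * w) * (l - 1) - 1 := by nlinarith
    exact mul_pos (by linarith) (mul_pos hw (mul_pos (by linarith) this))
  linarith

/-- For an integer `ℓ ≥ 2` and a real `r ≥ 3`, the function `Ψ_r` is strictly
increasing on `[0,1]`. -/
theorem psi_strictMono_of_three_le (ℓ : ℕ) (hℓ : 2 ≤ ℓ) (r : ℝ) (hr : 3 ≤ r) :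
    StrictMonoOn (Psi ℓ r) (Set.Icc 0 1) := by
  have hl : (2 : ℝ) ≤ ℓ := by exact_mod_cast hℓ
  generalize hL : (ℓ : ℝ) = l at hl
  have hD : ∀ w : ℝ, 0 ≤ w → 0 < 2 + 2 * l * w + l * (l + 1) * w ^ 2 := fun w hw ↦ by positivity
  have hderiv : ∀ w ∈ Set.Icc (0 : ℝ) 1, HasDerivAt (Psi ℓ r)
      (((l * r * (1 + l * w) ^ (r - 1) + l * (r * w ^ (r - 1))) *
          (2 + 2 * l * w + l * (l + 1) * w ^ 2) ^ (r / 2) -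
        ((1 + l * w) ^ r + 1 + l * w ^ r) *
          ((2 * l + l * (l + 1) * (2 * w)) * (r / 2) *
            (2 + 2 * l * w + l * (l + 1) * w ^ 2) ^ (r / 2 - 1))) /
        ((2 + 2 * l * w + l * (l + 1) * w ^ 2) ^ (r / 2)) ^ 2) w := by
    intro w hw
    have hA : HasDerivAt (fun x : ℝ ↦ 1 + l * x) l w := by
      simpa using ((hasDerivAt_id w).const_mul l).const_add 1
    have hQ : HasDerivAt (fun x : ℝ ↦ 2 + 2 * l * x + l * (l + 1) * x ^ 2)
        (2 * l + l * (l + 1) * (2 * w)) w := by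
      simpa using (((hasDerivAt_id w).const_mul (2 * l)).const_add 2).fun_add
        ((hasDerivAt_pow 2 w).const_mul (l * (l + 1)))
    have hN := ((hA.rpow_const (p := r) (.inr (by linarith))).add_const 1).add
      ((Real.hasDerivAt_rpow_const (x := w) (p := r) (.inr (by linarith))).const_mul l)
    have h := hN.div (hQ.rpow_const (p := r / 2) (.inl (hD w hw.1).ne'))
      (Real.rpow_pos_of_pos (hD w hw.1) _).ne'
    rw [← hL] at h ⊢
    exact h
  refine strictMonoOn_of_deriv_pos (convex_Icc 0 1)
    (fun w hw ↦ (hderiv w hw).continuousAt.continuousWithinAt) fun w hw ↦ ?_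
  rw [(hderiv w (interior_subset hw)).deriv]
  rw [interior_Icc] at hw
  obtain ⟨hw0, hw1⟩ := hw
  have hF := rpow_combination_pos hl hw0 hw1 (s := r - 1) (by linarith)
  have hA0 : 0 < 1 + l * w := by positivity
  have hq := hD w hw0.le
  have hAr : (1 + l * w) ^ r = (1 + l * w) ^ (r - 1) * (1 + l * w) := by
    rw [Real.rpow_sub_one hA0.ne', div_mul_cancel₀ _ hA0.ne']
  have hwr : w ^ r = w ^ (r - 1) * w := by
    rw [Real.rpow_sub_one hw0.ne', div_mul_cancel₀ _ hw0.ne']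
  have hqr : (2 + 2 * l * w + l * (l + 1) * w ^ 2) ^ (r / 2) =
      (2 + 2 * l * w + l * (l + 1) * w ^ 2) ^ (r / 2 - 1) *
        (2 + 2 * l * w + l * (l + 1) * w ^ 2) := by
    rw [Real.rpow_sub_one hq.ne', div_mul_cancel₀ _ hq.ne']
  refine div_pos ?_ (by positivity)
  have hpos := mul_pos (mul_pos (mul_pos (by linarith : 0 < l) (by linarith : 0 < r))
    (Real.rpow_pos_of_pos hq (r / 2 - 1))) hF
  rw [hAr, hwr, hqr]
  linarith
end
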